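/- arXiv:2503.08971 — 2 statements merged into one kernel-verified Lean document; each statement's English description precedes it below -/
import Mathlib

section
/- Let D be a DAG on a finite index set I with finite value types, and let X, Y, and Z ∪ T be pairwise disjoint subsets of I. Suppose Z is an adjustment set relative to (X, Y) in D, X is d-separated from Z \ T given T in D, and Y is d-separated from T \ Z given Z ∪ X in D (a d-separation statement whose left or right set is empty holds trivially). Then T is an adjustment set relative to (X, Y) in D. -/
open scoped Classical

variable {V : Type*}

/-- `a` is an ancestor of `b` (every vertex is its own ancestor). -/
def Anc (E : V → V → Prop) (a b : V) : Prop := Relation.ReflTransGen E a b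

/-- A path in a directed graph `E` from `a` to `b`: a sequence of distinct vertices
`a = vtx 0, …, vtx len = b` (`len ≥ 1`) in which consecutive vertices are joined
by an edge of `E` in either direction. -/
structure GPath (E : V → V → Prop) (a b : V) where
  len : ℕ
  len_pos : 0 < len
  vtx : ℕ → V
  first : vtx 0 = a
  last : vtx len = b
  inj : ∀ i j, i ≤ len → j ≤ len → vtx i = vtx j → i = j
  adj : ∀ i, i < len → E (vtx i) (vtx (i + 1)) ∨ E (vtx (i + 1)) (vtx i)

namespace GPath

variable {E : V → V → Prop} {a b : V}

/-- The interior vertex at position `i` is a collider on the path. -/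
def IsColliderAt (p : GPath E a b) (i : ℕ) : Prop :=
  0 < i ∧ i < p.len ∧ E (p.vtx (i - 1)) (p.vtx i) ∧ E (p.vtx (i + 1)) (p.vtx i)

/-- A path is open given `S` if no non-collider on it lies in `S` and every collider
on it has a descendant in `S`. -/
def OpenGiven (p : GPath E a b) (S : Set V) : Prop :=
  (∀ i, 0 < i → i < p.len → ¬ p.IsColliderAt i → p.vtx i ∉ S) ∧
  (∀ i, p.IsColliderAt i → ∃ d ∈ S, Anc E (p.vtx i) d)

/-- A back-door path: the first edge points into the first vertex. -/
def IsBackdoor (p : GPath E a b) : Prop := E (p.vtx 1) (p.vtx 0)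

/-- A causal (directed) path. -/
def Causal (p : GPath E a b) : Prop := ∀ i, i < p.len → E (p.vtx i) (p.vtx (i + 1))

/-- A path is proper with respect to `X` if only its first vertex lies in `X`. -/
def ProperFrom (p : GPath E a b) (X : Set V) : Prop :=
  ∀ i, 0 < i → i ≤ p.len → p.vtx i ∉ X

/-- The vertex `w` lies on the path. -/
def MemV (p : GPath E a b) (w : V) : Prop := ∃ i ≤ p.len, p.vtx i = w

/-- The number of colliders on the path. -/
noncomputable def numColliders (p : GPath E a b) : ℕ := Set.ncard {i | p.IsColliderAt i}

end GPath

/-- `A` and `B` are d-separated given `S`: every path from `A` to `B` is blocked given `S`. -/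
def DSep (E : V → V → Prop) (A B S : Set V) : Prop :=
  ∀ a ∈ A, ∀ b ∈ B, ∀ p : GPath E a b, ¬ p.OpenGiven S

/-- `A` and `B` are d-connected given `S`: some path from `A` to `B` is open given `S`. -/
def DConn (E : V → V → Prop) (A B S : Set V) : Prop :=
  ∃ a ∈ A, ∃ b ∈ B, ∃ p : GPath E a b, p.OpenGiven S

/-- The set of descendants of a vertex set `S`. -/
def descendants (E : V → V → Prop) (S : Set V) : Set V := {d | ∃ s ∈ S, Anc E s d}

/-- `S` blocks every back-door path from `x` to `y`. -/
def BlocksBackdoor (E : V → V → Prop) (x y : V) (S : Set V) : Prop :=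
  ∀ p : GPath E x y, p.IsBackdoor → ¬ p.OpenGiven S

/-- The back-door criterion for `Z` relative to `(X, Y)`. -/
def BackdoorCriterion (E : V → V → Prop) (X Y Z : Set V) : Prop :=
  Z ∩ descendants E X = ∅ ∧
  ∀ x ∈ X, ∀ y ∈ Y, BlocksBackdoor E x y (Z ∪ (X \ {x}))

/-- The adjustment criterion for `Z` relative to `(X, Y)`: (a) `Z` contains no
descendant of any `w ∉ X` lying on a proper causal path from `X` to `Y`, and
(b) `Z` blocks every proper non-causal path from `X` to `Y`. -/
def AdjustmentCriterion (E : V → V → Prop) (X Y Z : Set V) : Prop :=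
  (∀ w, w ∉ X →
      (∃ x ∈ X, ∃ y ∈ Y, ∃ p : GPath E x y, p.ProperFrom X ∧ p.Causal ∧ p.MemV w) →
      ∀ z ∈ Z, ¬ Anc E w z) ∧
  (∀ x ∈ X, ∀ y ∈ Y, ∀ p : GPath E x y, p.ProperFrom X → ¬ p.Causal → ¬ p.OpenGiven Z)

variable {I : Type*} [Fintype I] {α : I → Type*} [∀ i, Fintype (α i)] [∀ i, Nonempty (α i)]

/-- The marginal probability, under the joint pmf `p`, that the coordinates in `S`
take the values `x` assigns them. -/
noncomputable def prS (p : (∀ i, α i) → ℝ) (S : Set I) (x : ∀ i, α i) : ℝ :=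
  ∑ᶠ v ∈ {v : ∀ i, α i | ∀ i ∈ S, v i = x i}, p v

/-- `p` is a joint probability mass function. -/
def IsPMF (p : (∀ i, α i) → ℝ) : Prop := (∀ v, 0 ≤ p v) ∧ ∑ᶠ v, p v = 1

/-- The conditional probability of the assignment `x` on `A` given its values on `S`. -/
noncomputable def condPr (p : (∀ i, α i) → ℝ) (A S : Set I) (x : ∀ i, α i) : ℝ :=
  prS p (A ∪ S) x / prS p S x

/-- Conditional independence `A ⫫ B | S` under `p`. -/
def CondIndep (p : (∀ i, α i) → ℝ) (A B S : Set I) : Prop :=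
  ∀ x : ∀ i, α i, condPr p (A ∪ B) S x = condPr p A S x * condPr p B S x

/-- `p` is Markov compatible with the DAG `E`: it factorizes along parents. -/
def MarkovCompat (p : (∀ i, α i) → ℝ) (E : I → I → Prop) : Prop :=
  ∀ v, p v = ∏ᶠ i, condPr p {i} {j | E j i} v

/-- `p` is faithful to `E`: conditional independence holds exactly for d-separations. -/
def Faithful (p : (∀ i, α i) → ℝ) (E : I → I → Prop) : Prop :=
  ∀ A B S : Set I, Disjoint A B → Disjoint S (A ∪ B) →
    (CondIndep p A B S ↔ DSep E A B S)

/-- The interventional pmf `p(v | do(x))` (the truncated factorization). -/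
noncomputable def doPMF (p : (∀ i, α i) → ℝ) (E : I → I → Prop) (X : Set I)
    (x v : ∀ i, α i) : ℝ :=
  if ∀ i ∈ X, v i = x i then ∏ᶠ i ∈ Xᶜ, condPr p {i} {j | E j i} v else 0

/-- Combine the assignment `x` on `X`, the partial assignment `z` on `Z`, and the
assignment `y` elsewhere into one full assignment. -/
noncomputable def mergeVals (X Z : Set I) (x : ∀ i, α i) (z : ∀ j : Z, α j.1)
    (y : ∀ i, α i) : ∀ i, α i :=
  fun i => if h : i ∈ Z then z ⟨i, h⟩ else if i ∈ X then x i else y i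

/-- `Z` is an adjustment set relative to `(X, Y)` in the DAG `E`: for every positive
pmf `q` that is Markov compatible with `E` and all value assignments `x`, `y`,
the interventional probability of `y` on `Y` under `do(x)` equals
`∑ z, q(y | x, z) · q(z)`. -/
def IsAdjustmentSet (E : I → I → Prop) (X Y Z : Set I) : Prop :=
  ∀ q : (∀ i, α i) → ℝ, IsPMF q → (∀ v, 0 < q v) → MarkovCompat q E →
    ∀ x y : ∀ i, α i,
      (∑ᶠ v ∈ {v : ∀ i, α i | ∀ i ∈ Y, v i = y i}, doPMF q E X x v) =
      ∑ᶠ z : (∀ j : Z, α j.1),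
        condPr q Y (X ∪ Z) (mergeVals X Z x z y) * prS q Z (mergeVals X Z x z y)

/-- `Z` is a minimal adjustment set relative to `(X, Y)`: it is an adjustment set
and no proper subset of it is. -/
def MinimalAdjustmentSet (E : I → I → Prop) (X Y Z : Set I) : Prop :=
  IsAdjustmentSet (α := α) E X Y Z ∧ ∀ Z', Z' ⊂ Z → ¬ IsAdjustmentSet (α := α) E X Y Z'

/-! ### Graph part -/

inductive Reach (E : V → V → Prop) (A S : Set V) : V → Bool → Prop
  | start (a : V) (ha : a ∈ A) : Reach E A S a false
  | tailUp (v u : V) (h : Reach E A S v false) (hv : v ∉ S) (e : E u v) : Reach E A S u false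
  | down (v w : V) (d : Bool) (h : Reach E A S v d) (hv : v ∉ S) (e : E v w) : Reach E A S w true
  | coll (v u : V) (h : Reach E A S v true) (hv : ∃ s ∈ S, Anc E v s) (e : E u v) :
      Reach E A S u false

/-- An open walk of length `n` along `f`. -/
def OWalk (E : V → V → Prop) (S : Set V) (n : ℕ) (f : ℕ → V) : Prop :=
  (∀ i, i < n → E (f i) (f (i + 1)) ∨ E (f (i + 1)) (f i)) ∧
  (∀ i, 0 < i → i < n → ¬ (E (f (i - 1)) (f i) ∧ E (f (i + 1)) (f i)) → f i ∉ S) ∧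
  (∀ i, 0 < i → i < n → (E (f (i - 1)) (f i) ∧ E (f (i + 1)) (f i)) → ∃ s ∈ S, Anc E (f i) s)

theorem OWalk.extend {E : V → V → Prop} {S : Set V} {n : ℕ} {f : ℕ → V} (h : OWalk E S n f)
    (w : V) (hadj : E (f n) w ∨ E w (f n))
    (h1 : 0 < n → ¬ (E (f (n - 1)) (f n) ∧ E w (f n)) → f n ∉ S)
    (h2 : 0 < n → (E (f (n - 1)) (f n) ∧ E w (f n)) → ∃ s ∈ S, Anc E (f n) s) :
    OWalk E S (n + 1) (fun k => if k ≤ n then f k else w) := by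
  obtain ⟨a, b, c⟩ := h
  refine ⟨?_, ?_, ?_⟩
  · intro i hi
    rcases Nat.lt_or_ge i n with hin | hin
    · have e1 : i ≤ n := by omega
      have e2 : i + 1 ≤ n := by omega
      simpa [e1, e2] using a i hin
    · have e1 : i = n := by omega
      subst e1
      simpa using hadj
  · intro i hi0 hi
    rcases Nat.lt_or_ge i n with hin | hin
    · have e1 : i ≤ n := by omega
      have e2 : i + 1 ≤ n := by omega
      have e3 : i - 1 ≤ n := by omega
      simp only [e1, e2, e3, if_true]
      exact b i hi0 hin
    · have e1 : i = n := by omega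
      subst e1
      have e3 : i - 1 ≤ i := by omega
      simp only [le_refl, e3, if_true, show ¬ (i + 1 ≤ i) by omega, if_false]
      exact h1 hi0
  · intro i hi0 hi
    rcases Nat.lt_or_ge i n with hin | hin
    · have e1 : i ≤ n := by omega
      have e2 : i + 1 ≤ n := by omega
      have e3 : i - 1 ≤ n := by omega
      simp only [e1, e2, e3, if_true]
      exact c i hi0 hin
    · have e1 : i = n := by omega
      subst e1
      have e3 : i - 1 ≤ i := by omega
      simp only [le_refl, e3, if_true, show ¬ (i + 1 ≤ i) by omega, if_false]
      exact h2 hi0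

theorem dag_asymm {E : V → V → Prop} (hdag : ∀ x, ¬ Relation.TransGen E x x) {u v : V}
    (h1 : E u v) (h2 : E v u) : False :=
  hdag u (Relation.TransGen.tail (Relation.TransGen.single h1) h2)

theorem Reach.walk {E : V → V → Prop} (hdag : ∀ x, ¬ Relation.TransGen E x x) {A S : Set V}
    {v : V} {d : Bool} (h : Reach E A S v d) :
    ∃ n f, OWalk E S n f ∧ f 0 ∈ A ∧ f n = v ∧
      (d = false → 0 < n → E (f n) (f (n - 1))) ∧ (d = true → 0 < n → E (f (n - 1)) (f n)) := by
  induction h with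
  | start a ha =>
    refine ⟨0, fun _ => a, ⟨?_, ?_, ?_⟩, ha, rfl, ?_, ?_⟩ <;> intros <;> omega
  | tailUp v u h hv e ih =>
    obtain ⟨n, f, hw, h0, hn, ht, hh⟩ := ih
    subst hn
    refine ⟨n + 1, _, hw.extend u (Or.inr e) (fun _ _ => hv) ?_, ?_, ?_, ?_, ?_⟩
    · intro hpos hc
      exact (dag_asymm hdag hc.1 (ht rfl hpos)).elim
    · simpa using h0
    · simp
    · intro _ _
      simpa using e
    · intro h; cases h
  | down v w d h hv e ih =>
    obtain ⟨n, f, hw, h0, hn, ht, hh⟩ := ih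
    subst hn
    refine ⟨n + 1, _, hw.extend w (Or.inl e) (fun _ _ => hv) ?_, ?_, ?_, ?_, ?_⟩
    · intro hpos hc
      exact (dag_asymm hdag hc.2 e).elim
    · simpa using h0
    · simp
    · intro h; cases h
    · intro _ _
      simpa using e
  | coll v u h hv e ih =>
    obtain ⟨n, f, hw, h0, hn, ht, hh⟩ := ih
    subst hn
    refine ⟨n + 1, _, hw.extend u (Or.inr e) ?_ (fun _ _ => hv), ?_, ?_, ?_, ?_⟩
    · intro hpos hc
      exact (hc ⟨hh rfl hpos, e⟩).elim
    · simpa using h0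
    · simp
    · intro _ _
      simpa using e
    · intro h; cases h

theorem OWalk.desc {E : V → V → Prop} (hdag : ∀ x, ¬ Relation.TransGen E x x) {S : Set V}
    {n : ℕ} {f : ℕ → V} (h : OWalk E S n f) (j : ℕ) (hj : j ≤ n) (hje : E (f j) (f (j - 1))) :
    ∀ m k, k + 1 + m = j → E (f k) (f (k + 1)) → ∃ s ∈ S, Anc E (f k) s := by
  intro m
  induction m with
  | zero =>
    intro k hk e
    have : j = k + 1 := by omega
    subst this
    exact (dag_asymm hdag e (by simpa using hje)).elim
  | succ m ih =>
    intro k hk e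
    have : ∃ s ∈ S, Anc E (f (k + 1)) s := by
      rcases h.1 (k + 1) (by omega) with h1 | h1
      · exact ih (k + 1) (by omega) h1
      · exact h.2.2 (k + 1) (by omega) (by omega) ⟨by simpa using e, h1⟩
    obtain ⟨s, hs, ha⟩ := this
    exact ⟨s, hs, Relation.ReflTransGen.head e ha⟩

theorem OWalk.splice {E : V → V → Prop} (hdag : ∀ x, ¬ Relation.TransGen E x x) {S : Set V}
    {n : ℕ} {f : ℕ → V} (h : OWalk E S n f) (i c : ℕ) (hc : 0 < c) (hj : i + c ≤ n)
    (hij : f i = f (i + c)) :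
    OWalk E S (n - c) (fun k => if k ≤ i then f k else f (k + c)) := by
  have gge : ∀ k, i ≤ k → (if k ≤ i then f k else f (k + c)) = f (k + c) := by
    intro k hk
    split_ifs with h1
    · have : k = i := by omega
      subst this; exact hij
    · rfl
  have gle : ∀ k, k ≤ i → (if k ≤ i then f k else f (k + c)) = f k := by
    intro k hk; simp [hk]
  obtain ⟨a, b, d⟩ := id h
  refine ⟨?_, ?_, ?_⟩
  · intro k hk
    simp only
    rcases Nat.lt_or_ge k i with hki | hki
    · rw [gle k hki.le, gle (k + 1) hki]
      exact a k (by omega)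
    · rw [gge k hki, gge (k + 1) (by omega)]
      have := a (k + c) (by omega)
      rwa [show k + c + 1 = k + 1 + c by omega] at this
  · intro k hk0 hk
    simp only
    rcases Nat.lt_trichotomy k i with hki | hki | hki
    · rw [gle k hki.le, gle (k + 1) hki, gle (k - 1) (by omega)]
      exact b k hk0 (by omega)
    · subst hki
      rw [gle (k - 1) (by omega), gle k le_rfl, gge (k + 1) (by omega)]
      intro hn
      by_cases h1 : E (f (k - 1)) (f k)
      · have h2 : ¬ E (f (k + 1 + c)) (f k) := fun h2 => hn ⟨h1, h2⟩
        rw [hij]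
        apply b (k + c) (by omega) (by omega)
        intro h3
        apply h2
        have := h3.2
        rwa [show k + c + 1 = k + 1 + c by omega, ← hij] at this
      · exact b k hk0 (by omega) (fun h3 => h1 h3.1)
    · rw [gge k hki.le, gge (k + 1) (by omega), gge (k - 1) (by omega)]
      have := b (k + c) (by omega) (by omega)
      rwa [show k + c + 1 = k + 1 + c by omega, show k + c - 1 = k - 1 + c by omega] at this
  · intro k hk0 hk
    simp only
    rcases Nat.lt_trichotomy k i with hki | hki | hki
    · rw [gle k hki.le, gle (k + 1) hki, gle (k - 1) (by omega)]
      exact d k hk0 (by omega)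
    · subst hki
      rw [gle (k - 1) (by omega), gle k le_rfl, gge (k + 1) (by omega)]
      intro hn
      rcases a k (by omega) with h1 | h1
      · rcases a (k + c - 1) (by omega) with h2 | h2
        · rw [hij]
          apply d (k + c) (by omega) (by omega)
          rw [show k + c - 1 + 1 = k + c by omega] at h2
          refine ⟨h2, ?_⟩
          rw [← hij, show k + c + 1 = k + 1 + c by omega]
          exact hn.2
        · rw [show k + c - 1 + 1 = k + c by omega] at h2
          exact h.desc hdag (k + c) hj h2 (c - 1) k (by omega) h1
      · exact d k hk0 (by omega) ⟨hn.1, h1⟩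
    · rw [gge k hki.le, gge (k + 1) (by omega), gge (k - 1) (by omega)]
      have := d (k + c) (by omega) (by omega)
      rwa [show k + c + 1 = k + 1 + c by omega, show k + c - 1 = k - 1 + c by omega] at this

theorem OWalk.path {E : V → V → Prop} (hdag : ∀ x, ¬ Relation.TransGen E x x) {S : Set V}
    {a b : V} (hab : a ≠ b) :
    ∀ n f, OWalk E S n f → f 0 = a → f n = b → ∃ p : GPath E a b, p.OpenGiven S := by
  intro n
  induction n using Nat.strong_induction_on with
  | _ n ih =>
    intro f h h0 hn
    by_cases hinj : ∀ i j, i ≤ n → j ≤ n → f i = f j → i = j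
    · have hpos : 0 < n := by
        rcases Nat.eq_zero_or_pos n with h1 | h1
        · subst h1; exact (hab (h0.symm.trans hn)).elim
        · exact h1
      refine ⟨⟨n, hpos, f, h0, hn, hinj, h.1⟩, ?_, ?_⟩
      · intro i hi0 hi hcol
        exact h.2.1 i hi0 hi (fun hc => hcol ⟨hi0, hi, hc⟩)
      · rintro i ⟨hi0, hi, hc⟩
        exact h.2.2 i hi0 hi hc
    · have : ∃ i c, 0 < c ∧ i + c ≤ n ∧ f i = f (i + c) := by
        push Not at hinj
        obtain ⟨i, j, hi, hj, he, hne⟩ := hinj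
        rcases Nat.lt_or_gt_of_ne hne with h1 | h1
        · exact ⟨i, j - i, by omega, by omega, by rw [he]; congr 1; omega⟩
        · exact ⟨j, i - j, by omega, by omega, by rw [← he]; congr 1; omega⟩
      obtain ⟨i, c, hc, hj, hij⟩ := this
      refine ih (n - c) (by omega) _ (h.splice hdag i c hc hj hij) ?_ ?_
      · simpa using h0
      · split_ifs with h1
        · have : n - c = i := by omega
          rw [this, hij, ← hn]; congr 1; omega
        · rw [← hn]; congr 1; omega

theorem not_reach {E : V → V → Prop} (hdag : ∀ x, ¬ Relation.TransGen E x x) {A B S : Set V}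
    (hAB : Disjoint A B) (hsep : DSep E A B S) {b : V} (hb : b ∈ B) {d : Bool} :
    ¬ Reach E A S b d := by
  intro h
  obtain ⟨n, f, hw, h0, hn, -, -⟩ := h.walk hdag
  have hne : f 0 ≠ b := fun h => Set.disjoint_left.1 hAB h0 (h ▸ hb)
  obtain ⟨p, hp⟩ := OWalk.path hdag hne n f hw rfl hn
  exact hsep _ h0 _ hb p hp

theorem reach_family {E : V → V → Prop} (hdag : ∀ x, ¬ Relation.TransGen E x x) {A B S : Set V}
    (hAB : Disjoint A B) (hsep : DSep E A B S) {i u w : V}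
    (hi : ∃ t ∈ A ∪ B ∪ S, Anc E i t) (hu : u = i ∨ E u i) (hw : w = i ∨ E w i)
    (huS : u ∉ S) (huR : ∃ d, Reach E A S u d) : ∃ d, Reach E A S w d := by
  have hiR : ∃ d, Reach E A S i d := by
    obtain ⟨d, hd⟩ := huR
    rcases hu with rfl | hu
    · exact ⟨d, hd⟩
    · exact ⟨true, Reach.down u i d hd huS hu⟩
  rcases hw with rfl | hw
  · exact hiR
  by_cases hS : ∃ s ∈ S, Anc E i s
  · obtain ⟨d, hd⟩ := hiR
    cases d with
    | true => exact ⟨_, Reach.coll i w hd hS hw⟩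
    | false =>
      by_cases hiS : i ∈ S
      · rcases hu with rfl | hu
        · exact (huS hiS).elim
        · obtain ⟨d, hd⟩ := huR
          exact ⟨_, Reach.coll i w (Reach.down u i d hd huS hu) hS hw⟩
      · exact ⟨_, Reach.tailUp i w hd hiS hw⟩
  · have hiS : i ∉ S := fun h => hS ⟨i, h, Relation.ReflTransGen.refl⟩
    have down : ∀ t, Anc E i t → ∃ d, Reach E A S t d := by
      intro t ht
      induction ht with
      | refl => exact hiR
      | tail h1 h2 ih =>
        obtain ⟨d, hd⟩ := ih
        exact ⟨true, Reach.down _ _ d hd (fun h => hS ⟨_, h, h1⟩) h2⟩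
    obtain ⟨t, (ht | ht) | ht, hanc⟩ := hi
    · have : Reach E A S i false := by
        have key : ∀ j, Anc E j t → (¬ ∃ s ∈ S, Anc E j s) → Reach E A S j false := by
          intro j hj
          refine Relation.ReflTransGen.head_induction_on
            (motive := fun j _ => (¬ ∃ s ∈ S, Anc E j s) → Reach E A S j false) hj ?_ ?_
          · intro _
            exact Reach.start t ht
          · intro a c hac hc ih hn
            have hc' : ¬ ∃ s ∈ S, Anc E c s := fun ⟨s, hs, h⟩ =>
              hn ⟨s, hs, Relation.ReflTransGen.head hac h⟩
            exact Reach.tailUp c a (ih hc') (fun h => hc' ⟨c, h, Relation.ReflTransGen.refl⟩) hac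
        exact key i hanc hS
      exact ⟨_, Reach.tailUp i w this hiS hw⟩
    · obtain ⟨d, hd⟩ := down t hanc
      exact (not_reach hdag hAB hsep ht hd).elim
    · exact (hS ⟨t, ht, hanc⟩).elim

/-! ### Probability part -/

theorem prS_eq (p : (∀ i, α i) → ℝ) (S : Set I) (x : ∀ i, α i) :
    prS p S x = ∑ v, if (∀ i ∈ S, v i = x i) then p v else 0 := by
  unfold prS
  rw [finsum_mem_def, finsum_eq_sum_of_fintype]
  apply Finset.sum_congr rfl
  intro v _
  simp [Set.indicator_apply]

theorem prS_congr (p : (∀ i, α i) → ℝ) (S : Set I) {x y : ∀ i, α i} (h : ∀ i ∈ S, x i = y i) :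
    prS p S x = prS p S y := by
  rw [prS_eq, prS_eq]
  apply Finset.sum_congr rfl
  intro v _
  have : (∀ i ∈ S, v i = x i) ↔ (∀ i ∈ S, v i = y i) :=
    forall₂_congr fun i hi => by rw [h i hi]
  simp only [this]

theorem prS_pos {p : (∀ i, α i) → ℝ} (hp : ∀ v, 0 < p v) (S : Set I) (x : ∀ i, α i) :
    0 < prS p S x := by
  rw [prS_eq]
  apply Finset.sum_pos'
  · intro v _
    split_ifs
    · exact (hp v).le
    · exact le_rfl
  · exact ⟨x, Finset.mem_univ _, by simpa using hp x⟩

theorem prS_insert (p : (∀ i, α i) → ℝ) (S : Set I) (i : I) (hi : i ∉ S) (x : ∀ i, α i) :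
    ∑ a, prS p (insert i S) (Function.update x i a) = prS p S x := by
  simp only [prS_eq]
  rw [Finset.sum_comm]
  apply Finset.sum_congr rfl
  intro v _
  have : ∀ a, (∀ j ∈ insert i S, v j = Function.update x i a j) ↔
      (v i = a ∧ ∀ j ∈ S, v j = x j) := by
    intro a
    rw [Set.forall_mem_insert]
    simp only [Function.update_self]
    refine and_congr_right fun _ => forall₂_congr fun j hj => ?_
    rw [Function.update_of_ne (by rintro rfl; exact hi hj)]
  simp only [this, ite_and]
  simp

theorem condPr_congr (p : (∀ i, α i) → ℝ) (A S : Set I) {x y : ∀ i, α i}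
    (h : ∀ i ∈ A ∪ S, x i = y i) : condPr p A S x = condPr p A S y := by
  unfold condPr
  rw [prS_congr p _ h, prS_congr p S fun i hi => h i (Or.inr hi)]

theorem prS_ancestral {p : (∀ i, α i) → ℝ} (hp : ∀ v, 0 < p v) {E : I → I → Prop}
    (hdag : ∀ x, ¬ Relation.TransGen E x x) (hM : MarkovCompat p E) :
    ∀ n (W : Set I), (Wᶜ).ncard = n → (∀ i ∈ W, ∀ j, E j i → j ∈ W) → ∀ v,
      prS p W v = ∏ i, if i ∈ W then condPr p {i} {j | E j i} v else 1 := by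
  intro n
  induction n with
  | zero =>
    intro W hW _ v
    have hW' : W = Set.univ := by
      rw [Set.ncard_eq_zero (Set.toFinite _)] at hW
      exact Set.compl_empty_iff.1 hW
    subst hW'
    rw [prS_eq]
    have hiff : ∀ u : (∀ i, α i), (∀ i ∈ (Set.univ : Set I), u i = v i) ↔ u = v := by
      intro u
      simp [funext_iff]
    simp only [hiff]
    rw [Finset.sum_ite_eq' Finset.univ v p, if_pos (Finset.mem_univ _), hM v,
      finprod_eq_prod_of_fintype]
    simp
  | succ n ih =>
    intro W hW hcl v
    have hne : (Wᶜ).Nonempty := by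
      rw [← Set.ncard_pos (Set.toFinite _)]; omega
    have wf : WellFounded (Relation.TransGen E) := by
      haveI : Std.Irrefl (Relation.TransGen E) := ⟨hdag⟩
      exact Finite.wellFounded_of_trans_of_irrefl _
    obtain ⟨i, hiW, hmin⟩ := wf.has_min _ hne
    have hpar : ∀ j, E j i → j ∈ W := by
      intro j hj
      by_contra hjW
      exact hmin j hjW (Relation.TransGen.single hj)
    have hiW' : i ∉ W := hiW
    have hcard : ((insert i W)ᶜ).ncard = n := by
      have : (insert i W)ᶜ = Wᶜ \ {i} := by
        ext j; simp [not_or, and_comm]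
      rw [this, Set.ncard_sdiff_singleton_of_mem hiW]; omega
    have hcl' : ∀ k ∈ insert i W, ∀ j, E j k → j ∈ insert i W := by
      rintro k (rfl | hk) j hj
      · exact Or.inr (hpar j hj)
      · exact Or.inr (hcl k hk j hj)
    rw [← prS_insert p W i hiW']
    have step : ∀ a, prS p (insert i W) (Function.update v i a) =
        condPr p {i} {j | E j i} (Function.update v i a) *
        ∏ k, if k ∈ W then condPr p {k} {j | E j k} v else 1 := by
      intro a
      rw [ih _ hcard hcl', ← Finset.mul_prod_erase _ _ (Finset.mem_univ i),
        ← Finset.mul_prod_erase _ (fun k => if k ∈ W then condPr p {k} {j | E j k} v else 1)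
          (Finset.mem_univ i)]
      simp only [Set.mem_insert_iff, true_or, if_true, hiW', if_false, one_mul]
      congr 1
      apply Finset.prod_congr rfl
      intro k hk
      have hki : k ≠ i := Finset.ne_of_mem_erase hk
      simp only [hki, false_or]
      split_ifs with hkW
      · apply condPr_congr
        rintro j (hj | hj)
        · rw [Set.mem_singleton_iff] at hj
          subst hj
          exact Function.update_of_ne hki _ _
        · have : j ≠ i := by
            rintro rfl
            exact hiW' (hcl k hkW _ hj)
          exact Function.update_of_ne this _ _
      · rfl
    simp only [step]
    rw [← Finset.sum_mul]
    have hii : i ∉ {j | E j i} := fun h => hdag i (Relation.TransGen.single h)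
    have : ∑ a, condPr p {i} {j | E j i} (Function.update v i a) = 1 := by
      have h1 : ∀ a, condPr p {i} {j | E j i} (Function.update v i a) =
          prS p (insert i {j | E j i}) (Function.update v i a) / prS p {j | E j i} v := by
        intro a
        unfold condPr
        rw [Set.singleton_union]
        congr 1
        apply prS_congr
        intro j hj
        exact Function.update_of_ne (by rintro rfl; exact hii hj) _ _
      simp only [h1]
      rw [← Finset.sum_div, prS_insert p _ i hii]
      exact div_self (prS_pos hp _ _).ne'
    rw [this, one_mul]

theorem prS_tower (p : (∀ i, α i) → ℝ) (S W : Set I) (hSW : S ⊆ W) (v : ∀ i, α i) :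
    prS p S v = ∑ u, if (∀ i ∈ S ∪ Wᶜ, u i = v i) then prS p W u else 0 := by
  have h1 : ∀ u, (if (∀ i ∈ S ∪ Wᶜ, u i = v i) then prS p W u else 0) =
      ∑ u', if (∀ i ∈ S ∪ Wᶜ, u i = v i) ∧ (∀ i ∈ W, u' i = u i) then p u' else 0 := by
    intro u
    rw [prS_eq]
    split_ifs with h
    · apply Finset.sum_congr rfl
      intro u' _
      by_cases h' : ∀ i ∈ W, u' i = u i
      · rw [if_pos h', if_pos ⟨h, h'⟩]
      · rw [if_neg h', if_neg (fun hh => h' hh.2)]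
    · symm
      apply Finset.sum_eq_zero
      intro u' _
      rw [if_neg (fun hh => h hh.1)]
  simp only [h1]
  rw [Finset.sum_comm, prS_eq]
  apply Finset.sum_congr rfl
  intro u' _
  have h2 : ∀ u, ((∀ i ∈ S ∪ Wᶜ, u i = v i) ∧ (∀ i ∈ W, u' i = u i)) ↔
      (u = (fun i => if i ∈ W then u' i else v i) ∧ ∀ i ∈ S, u' i = v i) := by
    intro u
    constructor
    · rintro ⟨a, b⟩
      refine ⟨?_, fun i hi => (b i (hSW hi)).trans (a i (Or.inl hi))⟩
      funext i
      split_ifs with h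
      · exact (b i h).symm
      · exact a i (Or.inr h)
    · rintro ⟨rfl, b⟩
      refine ⟨?_, ?_⟩
      · rintro i (hi | hi)
        · simp [hSW hi, b i hi]
        · have : i ∉ W := hi
          simp [this]
      · intro i hi
        simp [hi]
  simp only [h2, ite_and]
  simp

theorem swap_sum (F G : (∀ i, α i) → ℝ) (A' A B S : Set I) (hA : A ⊆ A')
    (hB : Disjoint B A') (hS : Disjoint S A')
    (hF : ∀ u w, (∀ i ∈ A' ∪ S, u i = w i) → F u = F w)
    (hG : ∀ u w, (∀ i, i ∉ A' → u i = w i) → G u = G w) (v : ∀ i, α i) :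
    (∑ u, if (∀ i ∈ A ∪ B ∪ S, u i = v i) then F u * G u else 0) *
      (∑ u, if (∀ i ∈ S, u i = v i) then F u * G u else 0) =
    (∑ u, if (∀ i ∈ A ∪ S, u i = v i) then F u * G u else 0) *
      (∑ u, if (∀ i ∈ B ∪ S, u i = v i) then F u * G u else 0) := by
  rw [Finset.sum_mul_sum, Finset.sum_mul_sum, ← Fintype.sum_prod_type', ← Fintype.sum_prod_type']
  let e : ((∀ i, α i) × (∀ i, α i)) → ((∀ i, α i) × (∀ i, α i)) := fun x =>
    (fun i => if i ∈ A' then x.1 i else x.2 i, fun i => if i ∈ A' then x.2 i else x.1 i)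
  have he : Function.Involutive e := by
    rintro ⟨u, w⟩
    simp only [e, Prod.mk.injEq]
    constructor <;> funext i <;> by_cases h : i ∈ A' <;> simp [h]
  rw [← Equiv.sum_comp (he.toPerm e)]
  apply Finset.sum_congr rfl
  rintro ⟨u, w⟩ _
  simp only [Function.Involutive.coe_toPerm, e]
  rw [ite_zero_mul_ite_zero, ite_zero_mul_ite_zero]
  have hBn : ∀ i ∈ B, i ∉ A' := fun i hi => Set.disjoint_left.1 hB hi
  have hSn : ∀ i ∈ S, i ∉ A' := fun i hi => Set.disjoint_left.1 hS hi
  have hiff : ((∀ i ∈ A ∪ B ∪ S, (if i ∈ A' then u i else w i) = v i) ∧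
      ∀ i ∈ S, (if i ∈ A' then w i else u i) = v i) ↔
      ((∀ i ∈ A ∪ S, u i = v i) ∧ ∀ i ∈ B ∪ S, w i = v i) := by
    constructor
    · rintro ⟨a, b⟩
      refine ⟨?_, ?_⟩
      · rintro i (hi | hi)
        · simpa [hA hi] using a i (Or.inl (Or.inl hi))
        · simpa [hSn i hi] using b i hi
      · rintro i (hi | hi)
        · simpa [hBn i hi] using a i (Or.inl (Or.inr hi))
        · simpa [hSn i hi] using a i (Or.inr hi)
    · rintro ⟨a, b⟩
      refine ⟨?_, ?_⟩
      · rintro i ((hi | hi) | hi)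
        · simpa [hA hi] using a i (Or.inl hi)
        · simpa [hBn i hi] using b i (Or.inl hi)
        · simpa [hSn i hi] using b i (Or.inr hi)
      · intro i hi
        simpa [hSn i hi] using a i (Or.inr hi)
  simp only [hiff]
  split_ifs with h
  · obtain ⟨a, b⟩ := h
    rw [hF (fun i => if i ∈ A' then u i else w i) u, hF (fun i => if i ∈ A' then w i else u i) w,
      hG (fun i => if i ∈ A' then u i else w i) w, hG (fun i => if i ∈ A' then w i else u i) u]
    · ring
    · intro i hi; simp [hi]
    · intro i hi; simp [hi]
    · rintro i (hi | hi)
      · simp [hi]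
      · simp only [hSn i hi, if_false]
        rw [a i (Or.inr hi), b i (Or.inr hi)]
    · rintro i (hi | hi)
      · simp [hi]
      · simp only [hSn i hi, if_false]
        rw [a i (Or.inr hi), b i (Or.inr hi)]
  · rfl

/-- Global Markov property. -/
theorem dsep_sound {p : (∀ i, α i) → ℝ} (hp : ∀ v, 0 < p v) {E : I → I → Prop}
    (hdag : ∀ x, ¬ Relation.TransGen E x x) (hM : MarkovCompat p E) {A B S : Set I}
    (hAB : Disjoint A B) (hAS : Disjoint A S) (hBS : Disjoint B S) (hsep : DSep E A B S)
    (v : ∀ i, α i) :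
    prS p (A ∪ B ∪ S) v * prS p S v = prS p (A ∪ S) v * prS p (B ∪ S) v := by
  set W : Set I := {i | ∃ t ∈ A ∪ B ∪ S, Anc E i t} with hWdef
  have hsub : A ∪ B ∪ S ⊆ W := fun i hi => ⟨i, hi, Relation.ReflTransGen.refl⟩
  have hcl : ∀ i ∈ W, ∀ j, E j i → j ∈ W := by
    rintro i ⟨t, ht, h⟩ j hj
    exact ⟨t, ht, Relation.ReflTransGen.head hj h⟩
  set A' : Set I := {i | i ∈ W ∧ i ∉ S ∧ ∃ d, Reach E A S i d} with hA'def
  let k : I → (∀ i, α i) → ℝ := fun i v => condPr p {i} {j | E j i} v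
  let C : I → Prop := fun i => ∃ u, (u = i ∨ E u i) ∧ u ∈ A'
  let F : (∀ i, α i) → ℝ := fun v => ∏ i, if i ∈ W ∧ C i then k i v else 1
  let G : (∀ i, α i) → ℝ := fun v => ∏ i, if i ∈ W ∧ ¬ C i then k i v else 1
  have hFG : ∀ u, prS p W u = F u * G u := by
    intro u
    rw [prS_ancestral hp hdag hM _ W rfl hcl u, ← Finset.prod_mul_distrib]
    apply Finset.prod_congr rfl
    intro i _
    by_cases h1 : i ∈ W <;> by_cases h2 : C i <;> simp [h1, h2, k]
  have hF : ∀ u w, (∀ i ∈ A' ∪ (S ∪ Wᶜ), u i = w i) → F u = F w := by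
    intro u w h
    apply Finset.prod_congr rfl
    intro i _
    split_ifs with hi
    · obtain ⟨hiW, t, hti, htW, htS, htR⟩ := hi
      apply condPr_congr
      have hfam : ∀ j, (j = i ∨ E j i) → u j = w j := by
        intro j hj
        by_cases hjS : j ∈ S
        · exact h j (Or.inr (Or.inl hjS))
        · refine h j (Or.inl ⟨?_, hjS, reach_family hdag hAB hsep hiW hti hj htS htR⟩)
          rcases hj with rfl | hj
          · exact hiW
          · exact hcl i hiW j hj
      rintro j (hj | hj)
      · exact hfam j (Or.inl hj)
      · exact hfam j (Or.inr hj)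
    · rfl
  have hG : ∀ u w, (∀ i, i ∉ A' → u i = w i) → G u = G w := by
    intro u w h
    apply Finset.prod_congr rfl
    intro i _
    split_ifs with hi
    · apply condPr_congr
      rintro j (hj | hj)
      · exact h j fun hjA => hi.2 ⟨j, Or.inl hj, hjA⟩
      · exact h j fun hjA => hi.2 ⟨j, Or.inr hj, hjA⟩
    · rfl
  have hA : A ⊆ A' := fun a ha =>
    ⟨hsub (Or.inl (Or.inl ha)), Set.disjoint_left.1 hAS ha, false, Reach.start a ha⟩
  have hB : Disjoint B A' := by
    rw [Set.disjoint_left]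
    rintro b hb ⟨_, _, d, hd⟩
    exact not_reach hdag hAB hsep hb hd
  have hS : Disjoint (S ∪ Wᶜ) A' := by
    rw [Set.disjoint_left]
    rintro b (hb | hb) ⟨h1, h2, _⟩
    · exact h2 hb
    · exact hb h1
  have main := swap_sum F G A' A B (S ∪ Wᶜ) hA hB hS hF hG v
  rw [prS_tower p (A ∪ B ∪ S) W hsub, prS_tower p S W fun i hi => hsub (Or.inr hi),
    prS_tower p (A ∪ S) W (fun i hi => hsub (by rcases hi with hi | hi
                                                · exact Or.inl (Or.inl hi)
                                                · exact Or.inr hi)),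
    prS_tower p (B ∪ S) W (fun i hi => hsub (by rcases hi with hi | hi
                                                · exact Or.inl (Or.inr hi)
                                                · exact Or.inr hi))]
  simp only [hFG]
  simp only [Set.union_assoc] at main ⊢
  convert main

theorem adj_sum (q g : (∀ i, α i) → ℝ) (X S : Set I) (x y : ∀ i, α i) :
    (∑ᶠ z : (∀ j : S, α j.1), g (mergeVals X S x z y) * prS q S (mergeVals X S x z y)) =
      ∑ u, q u * g (mergeVals X S x (fun j => u j.1) y) := by
  rw [finsum_eq_sum_of_fintype]
  simp only [prS_eq, Finset.mul_sum]
  rw [Finset.sum_comm]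
  apply Finset.sum_congr rfl
  intro u _
  have : ∀ z : (∀ j : S, α j.1), (∀ i ∈ S, u i = mergeVals X S x z y i) ↔
      (fun j : S => u j.1) = z := by
    intro z
    constructor
    · intro h
      funext j
      rw [h j.1 j.2]
      simp [mergeVals]
    · rintro rfl i hi
      simp [mergeVals, hi]
  simp only [this, mul_ite, mul_zero]
  rw [Finset.sum_ite_eq Finset.univ, if_pos (Finset.mem_univ _), mul_comm]

theorem ipw (q : (∀ i, α i) → ℝ) (X Y S : Set I) (hXY : Disjoint X Y) (hXS : Disjoint X S)
    (hYS : Disjoint Y S) (x y : ∀ i, α i) :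
    (∑ u, q u * condPr q Y (X ∪ S) (mergeVals X S x (fun j => u j.1) y)) =
      ∑ u', if (∀ i ∈ X, u' i = x i) ∧ (∀ i ∈ Y, u' i = y i) then
        q u' * (prS q S u' / prS q (X ∪ S) u') else 0 := by
  have hX : ∀ u : (∀ i, α i), ∀ i ∈ X, mergeVals X S x (fun j => u j.1) y i = x i := by
    intro u i hi
    have : i ∉ S := Set.disjoint_left.1 hXS hi
    simp [mergeVals, hi, this]
  have hY : ∀ u : (∀ i, α i), ∀ i ∈ Y, mergeVals X S x (fun j => u j.1) y i = y i := by
    intro u i hi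
    have h1 : i ∉ S := Set.disjoint_left.1 hYS hi
    have h2 : i ∉ X := Set.disjoint_right.1 hXY hi
    simp [mergeVals, h1, h2]
  have hSS : ∀ u : (∀ i, α i), ∀ i ∈ S, mergeVals X S x (fun j => u j.1) y i = u i := by
    intro u i hi
    simp [mergeVals, hi]
  have h1 : ∀ u : (∀ i, α i), q u * condPr q Y (X ∪ S) (mergeVals X S x (fun j => u j.1) y) =
      ∑ u', if ((∀ i ∈ X, u' i = x i) ∧ (∀ i ∈ Y, u' i = y i)) ∧ (∀ i ∈ S, u i = u' i) then
        q u * (q u' / prS q (X ∪ S) u') else 0 := by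
    intro u
    rw [condPr, prS_eq q (Y ∪ (X ∪ S)), Finset.sum_div, Finset.mul_sum]
    apply Finset.sum_congr rfl
    intro u' _
    have hiff : (∀ i ∈ Y ∪ (X ∪ S), u' i = mergeVals X S x (fun j => u j.1) y i) ↔
        (((∀ i ∈ X, u' i = x i) ∧ (∀ i ∈ Y, u' i = y i)) ∧ (∀ i ∈ S, u i = u' i)) := by
      constructor
      · intro h
        exact ⟨⟨fun i hi => (h i (Or.inr (Or.inl hi))).trans (hX u i hi),
          fun i hi => (h i (Or.inl hi)).trans (hY u i hi)⟩,
          fun i hi => ((h i (Or.inr (Or.inr hi))).trans (hSS u i hi)).symm⟩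
      · rintro ⟨⟨a, b⟩, c⟩ i (hi | hi | hi)
        · rw [b i hi, hY u i hi]
        · rw [a i hi, hX u i hi]
        · rw [← c i hi, hSS u i hi]
    by_cases h : ∀ i ∈ Y ∪ (X ∪ S), u' i = mergeVals X S x (fun j => u j.1) y i
    · rw [if_pos h, if_pos (hiff.1 h), prS_congr q (X ∪ S) fun i hi => h i (Or.inr hi)]
    · rw [if_neg h, if_neg (fun h' => h (hiff.2 h'))]
      simp
  simp only [h1]
  rw [Finset.sum_comm]
  apply Finset.sum_congr rfl
  intro u' _
  by_cases h : (∀ i ∈ X, u' i = x i) ∧ (∀ i ∈ Y, u' i = y i)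
  · rw [if_pos h]
    simp only [eq_true h, true_and]
    rw [prS_eq q S u', Finset.sum_div, Finset.mul_sum]
    apply Finset.sum_congr rfl
    intro u _
    split_ifs
    · ring
    · simp
  · rw [if_neg h]
    simp only [eq_false h, false_and, if_false, Finset.sum_const_zero]

/-- **C-equivalence via d-separation.** If `Z` is an adjustment set relative to
`(X, Y)` in the DAG `E`, `X` is d-separated from `Z \ T` given `T`, and `Y` is
d-separated from `T \ Z` given `Z ∪ X`, then `T` is an adjustment set relative to
`(X, Y)`. -/
theorem stmt_3 (E : I → I → Prop)
    (hdag : Irreflexive (Relation.TransGen E))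
    (X Y Z T : Set I)
    (hXY : Disjoint X Y) (hXZT : Disjoint X (Z ∪ T)) (hYZT : Disjoint Y (Z ∪ T))
    (hZadj : IsAdjustmentSet (α := α) E X Y Z)
    (hsep1 : DSep E X (Z \ T) T)
    (hsep2 : DSep E Y (T \ Z) (Z ∪ X)) :
    IsAdjustmentSet (α := α) E X Y T := by
  intro q hq hpos hM x y
  have hdag' : ∀ x, ¬ Relation.TransGen E x x := hdag
  rw [hZadj q hq hpos hM x y, adj_sum q (condPr q Y (X ∪ Z)), adj_sum q (condPr q Y (X ∪ T))]
  have hXT : Disjoint X T := hXZT.mono_right Set.subset_union_right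
  have hYT : Disjoint Y T := hYZT.mono_right Set.subset_union_right
  have hXZ : Disjoint X Z := hXZT.mono_right Set.subset_union_left
  have hYZ : Disjoint Y Z := hYZT.mono_right Set.subset_union_left
  have ci1 : ∀ v, prS q (X ∪ (Z ∪ T)) v * prS q T v = prS q (X ∪ T) v * prS q (Z ∪ T) v := by
    intro v
    have := dsep_sound hpos hdag' hM (hXZ.mono_right Set.sdiff_subset) hXT
      Set.disjoint_sdiff_left hsep1 v
    rwa [Set.union_assoc, Set.sdiff_union_self] at this
  have ci2 : ∀ v, prS q (Y ∪ (X ∪ (Z ∪ T))) v * prS q (X ∪ Z) v =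
      prS q (Y ∪ (X ∪ Z)) v * prS q (X ∪ (Z ∪ T)) v := by
    intro v
    have := dsep_sound hpos hdag' hM (hYT.mono_right Set.sdiff_subset)
      (Set.disjoint_union_right.2 ⟨hYZ, hXY.symm⟩)
      (Set.disjoint_union_right.2 ⟨Set.disjoint_sdiff_left,
        (hXT.mono_right Set.sdiff_subset).symm⟩) hsep2 v
    have e1 : T \ Z ∪ (Z ∪ X) = X ∪ (Z ∪ T) := by
      rw [← Set.union_assoc, Set.sdiff_union_self, Set.union_comm T Z, Set.union_comm]
    rwa [Set.union_assoc, e1, Set.union_comm Z X] at this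
  have step1 : ∀ u : (∀ i, α i), condPr q Y (X ∪ Z) (mergeVals X Z x (fun j => u j.1) y) =
      condPr q Y (X ∪ (Z ∪ T)) (mergeVals X (Z ∪ T) x (fun j => u j.1) y) := by
    intro u
    rw [condPr_congr q Y (X ∪ Z) (y := mergeVals X (Z ∪ T) x (fun j => u j.1) y)]
    · unfold condPr
      rw [div_eq_div_iff (prS_pos hpos _ _).ne' (prS_pos hpos _ _).ne']
      exact (ci2 _).symm
    · rintro i (hi | hi | hi)
      · have h1 : i ∉ Z := Set.disjoint_left.1 hYZ hi
        have h2 : i ∉ T := Set.disjoint_left.1 hYT hi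
        simp [mergeVals, h1, h2]
      · have h1 : i ∉ Z := Set.disjoint_left.1 hXZ hi
        have h2 : i ∉ T := Set.disjoint_left.1 hXT hi
        simp [mergeVals, h1, h2]
      · simp [mergeVals, hi]
  simp only [step1]
  rw [ipw q X Y (Z ∪ T) hXY hXZT hYZT, ipw q X Y T hXY hXT hYT]
  apply Finset.sum_congr rfl
  intro u _
  have : prS q (Z ∪ T) u / prS q (X ∪ (Z ∪ T)) u = prS q T u / prS q (X ∪ T) u := by
    rw [div_eq_div_iff (prS_pos hpos _ _).ne' (prS_pos hpos _ _).ne']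
    linarith [ci1 u]
  rw [this]
end

section
/- Let D be a DAG on a finite index set I with finite value types, and let p be a positive joint pmf that is Markov compatible with and faithful to D. Let X = {X₁, …, X_k} (k ≥ 1, distinct), {Y}, and W be pairwise disjoint subsets of I with causal ordering W < {X₁} < ⋯ < {X_k} < {Y} in D. Suppose there exist W₁, …, W_k ∈ W and Z ⊆ W \ {W₁, …, W_k} such that for every i ∈ {1, …, k}, under p: (i) W_i and Y are NOT conditionally independent given Z ∪ {X₁, …, X_{i-1}}, and (ii) W_i and Y are conditionally independent given Z ∪ {X₁, …, X_i}. Then for every i there is a directed path from X_i to Y in D with at least one edge, and Z is an adjustment set relative to (X, {Y}) in D. -/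
open scoped Classical

variable {V : Type*}

variable {I : Type*} [Fintype I] {α : I → Type*} [∀ i, Fintype (α i)] [∀ i, Nonempty (α i)]

/-- `r` has a descendant in `S`. -/
def AnS (E : V → V → Prop) (S : Set V) (r : V) : Prop := ∃ d ∈ S, Anc E r d

theorem AnS.step {E : V → V → Prop} {S : Set V} {r s : V} (h : AnS E S r) (e : E s r) :
    AnS E S s := by
  obtain ⟨d, hd, h⟩ := h
  exact ⟨d, hd, Relation.ReflTransGen.head e h⟩

/-- Reachability by open walks; the flag records whether the last edge points
into the current vertex. -/
inductive DR (E : V → V → Prop) (S : Set V) (w : V) : V → Bool → Prop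
  | start : DR E S w w false
  | child {r s : V} {d : Bool} : DR E S w r d → r ∉ S → E r s → DR E S w s true
  | parF {r s : V} : DR E S w r false → r ∉ S → E s r → DR E S w s false
  | parT {r s : V} : DR E S w r true → AnS E S r → E s r → DR E S w s false

/-- An open path of length `n ≥ 0` starting at `w`. -/
structure OP (E : V → V → Prop) (S : Set V) (w : V) (n : ℕ) (v : ℕ → V) : Prop where
  first : v 0 = w
  inj : ∀ i j, i ≤ n → j ≤ n → v i = v j → i = j
  adj : ∀ i, i < n → E (v i) (v (i + 1)) ∨ E (v (i + 1)) (v i)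
  nc : ∀ i, i + 1 < n → ¬ (E (v i) (v (i + 1)) ∧ E (v (i + 2)) (v (i + 1))) → v (i + 1) ∉ S
  co : ∀ i, i + 1 < n → E (v i) (v (i + 1)) → E (v (i + 2)) (v (i + 1)) → AnS E S (v (i + 1))

theorem OP.trunc {E : V → V → Prop} {S : Set V} {w : V} {n m : ℕ} {v : ℕ → V}
    (h : OP E S w n v) (hm : m ≤ n) : OP E S w m v where
  first := h.first
  inj i j hi hj := h.inj i j (hi.trans hm) (hj.trans hm)
  adj i hi := h.adj i (by omega)
  nc i hi := h.nc i (by omega)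
  co i hi := h.co i (by omega)

theorem OP.ext {E : V → V → Prop} {S : Set V} {w s : V} {n : ℕ} {v : ℕ → V}
    (h : OP E S w n v) (hs : ∀ i ≤ n, v i ≠ s) (e : E (v n) s ∨ E s (v n))
    (hnc : ∀ i, i + 1 = n → ¬ (E (v i) (v (i + 1)) ∧ E s (v (i + 1))) → v (i + 1) ∉ S)
    (hco : ∀ i, i + 1 = n → E (v i) (v (i + 1)) → E s (v (i + 1)) → AnS E S (v (i + 1))) :
    OP E S w (n + 1) (fun i => if i ≤ n then v i else s) where
  first := by simp [h.first]
  inj i j hi hj hij := by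
    by_cases h1 : i ≤ n <;> by_cases h2 : j ≤ n <;> simp only [h1, h2, if_true, if_false] at hij
    · exact h.inj i j h1 h2 hij
    · exact absurd hij (hs i h1)
    · exact absurd hij.symm (hs j h2)
    · omega
  adj i hi := by
    rcases Nat.lt_succ_iff_lt_or_eq.mp hi with h1 | rfl
    · simpa [h1.le, Nat.succ_le_of_lt h1] using h.adj i h1
    · simpa using e
  nc i hi := by
    rcases Nat.lt_succ_iff_lt_or_eq.mp hi with h1 | h1
    · have a1 : i ≤ n := by omega
      have a2 : i + 1 ≤ n := by omega
      have a3 : i + 2 ≤ n := by omega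
      simpa only [a1, a2, a3, if_true] using h.nc i h1
    · have a1 : i ≤ n := by omega
      have a2 : i + 1 ≤ n := by omega
      have a3 : ¬ (i + 2 ≤ n) := by omega
      simpa only [a1, a2, a3, if_true, if_false] using hnc i h1
  co i hi := by
    rcases Nat.lt_succ_iff_lt_or_eq.mp hi with h1 | h1
    · have a1 : i ≤ n := by omega
      have a2 : i + 1 ≤ n := by omega
      have a3 : i + 2 ≤ n := by omega
      simpa only [a1, a2, a3, if_true] using h.co i h1
    · have a1 : i ≤ n := by omega
      have a2 : i + 1 ≤ n := by omega
      have a3 : ¬ (i + 2 ≤ n) := by omega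
      simpa only [a1, a2, a3, if_true, if_false] using hco i h1

theorem OP.follow {E : V → V → Prop} {S : Set V} {w : V} {n : ℕ} {v : ℕ → V}
    (h : OP E S w n v) {a : ℕ} (e : E (v a) (v (a + 1))) :
    ∀ c, a + c < n → AnS E S (v a) ∨
      (E (v (a + c)) (v (a + c + 1)) ∧ Relation.TransGen E (v a) (v (a + c + 1))) := by
  intro c
  induction c with
  | zero => intro _; exact Or.inr ⟨e, Relation.TransGen.single e⟩
  | succ c ih =>
    intro hc
    rcases ih (by omega) with h1 | ⟨h1, h2⟩
    · exact Or.inl h1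
    · rcases h.adj (a + (c + 1)) hc with h3 | h3
      · exact Or.inr ⟨h3, h2.tail h3⟩
      · obtain ⟨d, hd, hd2⟩ := h.co (a + c) (by omega) h1 h3
        exact Or.inl ⟨d, hd, h2.to_reflTransGen.trans hd2⟩

theorem OP.back {E : V → V → Prop} {S : Set V} {w : V} {n : ℕ} {v : ℕ → V}
    (h : OP E S w n v) : ∀ a, a + 1 ≤ n → E (v (a + 1)) (v a) →
    AnS E S (v (a + 1)) ∨ Anc E (v (a + 1)) w := by
  intro a
  induction a with
  | zero => intro _ e; rw [← h.first]; exact Or.inr (Relation.ReflTransGen.single e)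
  | succ a ih =>
    intro ha e
    rcases h.adj a (by omega) with h1 | h1
    · exact Or.inl ((h.co a (by omega) h1 e).step e)
    · rcases ih (by omega) h1 with h2 | h2
      · exact Or.inl (h2.step e)
      · exact Or.inr (Relation.ReflTransGen.head e h2)

theorem dag_asymm_s5 {E : V → V → Prop} (hdag : Irreflexive (Relation.TransGen E)) {a b : V}
    (h : E a b) (h' : E b a) : False :=
  hdag a ((Relation.TransGen.single h).tail h')

theorem DR.exists_path {E : V → V → Prop} (hdag : Irreflexive (Relation.TransGen E))
    {S : Set V} {w : V} (hw : w ∉ S) {r : V} {d : Bool} (h : DR E S w r d) :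
    ∃ n v, OP E S w n v ∧ v n = r ∧
      (d = true → r ∈ S → ∃ m, m + 1 = n ∧ E (v m) (v (m + 1))) ∧
      (d = false → (∀ m, m + 1 = n → E (v (m + 1)) (v m)) ∨ AnS E S r) := by
  induction h with
  | start =>
    refine ⟨0, fun _ => w, ⟨rfl, ?_, ?_, ?_, ?_⟩, rfl, ?_, ?_⟩
    · intros; omega
    · intros; omega
    · intros; omega
    · intros; omega
    · simp
    · intro _; left; intros; omega
  | @child r s d hr hrS e ih =>
    obtain ⟨n, v, hv, rfl, -, -⟩ := ih
    by_cases hs : ∃ i ≤ n, v i = s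
    · obtain ⟨i, hi, rfl⟩ := hs
      refine ⟨i, v, hv.trunc hi, rfl, ?_, by simp⟩
      intro _ hiS
      have hin : i ≠ n := by rintro rfl; exact hrS hiS
      rcases i with _ | i
      · exact absurd (hv.first ▸ hiS) hw
      · refine ⟨i, rfl, ?_⟩
        by_contra hne
        exact hv.nc i (by omega) (fun h => hne h.1) hiS
    · push Not at hs
      refine ⟨n + 1, _, hv.ext hs (Or.inl e) ?_ ?_, by simp, ?_, by simp⟩
      · rintro i rfl _; exact hrS
      · rintro i rfl _ e2; exact (dag_asymm_s5 hdag e e2).elim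
      · intro _ _; exact ⟨n, rfl, by simpa using e⟩
  | @parF r s hr hrS e ih =>
    obtain ⟨n, v, hv, rfl, -, h2⟩ := ih
    have h2 := h2 rfl
    by_cases hs : ∃ i ≤ n, v i = s
    · obtain ⟨i, hi, rfl⟩ := hs
      refine ⟨i, v, hv.trunc hi, rfl, by simp, ?_⟩
      intro _
      rcases h2 with h2 | h2
      · by_contra hcon
        push Not at hcon
        obtain ⟨⟨m, rfl, hm⟩, hA⟩ := hcon
        have hmn : m + 1 ≠ n := by
          rintro rfl
          exact dag_asymm_s5 hdag e e
        have e1 : E (v m) (v (m + 1)) := (hv.adj m (by omega)).resolve_right hm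
        rcases hv.adj (m + 1) (by omega) with h3 | h3
        · obtain ⟨c, rfl⟩ : ∃ c, n = m + 1 + c + 1 := ⟨n - (m + 2), by omega⟩
          rcases hv.follow h3 c (by omega) with h4 | ⟨h4, _⟩
          · exact hA h4
          · exact dag_asymm_s5 hdag h4 (h2 _ rfl)
        · exact hA (hv.co m (by omega) e1 h3)
      · exact Or.inr (h2.step e)
    · push Not at hs
      refine ⟨n + 1, _, hv.ext hs (Or.inr e) ?_ ?_, by simp, by simp, ?_⟩
      · rintro i rfl _; exact hrS
      · rintro i rfl e1 _
        rcases h2 with h2 | h2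
        · exact (dag_asymm_s5 hdag e1 (h2 i rfl)).elim
        · exact h2
      · intro _; left; intro m hm
        obtain rfl : m = n := by omega
        simpa using e
  | @parT r s hr hrA e ih =>
    obtain ⟨n, v, hv, rfl, h1, -⟩ := ih
    have h1 := h1 rfl
    by_cases hs : ∃ i ≤ n, v i = s
    · obtain ⟨i, hi, rfl⟩ := hs
      exact ⟨i, v, hv.trunc hi, rfl, by simp, fun _ => Or.inr (hrA.step e)⟩
    · push Not at hs
      refine ⟨n + 1, _, hv.ext hs (Or.inr e) ?_ ?_, by simp, by simp, ?_⟩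
      · rintro i rfl hn hS
        obtain ⟨m, hm, hm2⟩ := h1 hS
        obtain rfl : m = i := by omega
        exact hn ⟨hm2, e⟩
      · rintro i rfl e1 _; exact hrA
      · intro _; left; intro m hm
        obtain rfl : m = n := by omega
        simpa using e

theorem DR.not_dsep {E : V → V → Prop} (hdag : Irreflexive (Relation.TransGen E))
    {S : Set V} {w y : V} (hw : w ∉ S) (hwy : w ≠ y) {d : Bool} (h : DR E S w y d) :
    ¬ DSep E {w} {y} S := by
  obtain ⟨n, v, hv, hn, -, -⟩ := h.exists_path hdag hw
  intro hsep
  have hn0 : 0 < n := by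
    rcases Nat.eq_zero_or_pos n with rfl | h0
    · exact absurd (hv.first.symm.trans hn) hwy
    · exact h0
  refine hsep w rfl y rfl ⟨n, hn0, v, hv.first, hn, hv.inj, hv.adj⟩ ⟨?_, ?_⟩
  · rintro (_ | i) h0 h1 h2
    · omega
    · exact hv.nc i h1 (fun h => h2 ⟨h0, h1, h.1, h.2⟩)
  · rintro (_ | i) ⟨h0, h1, h2, h3⟩
    · omega
    · exact hv.co i h1 h2 h3

theorem OP.of_open {E : V → V → Prop} {S : Set V} {a b : V} (p : GPath E a b)
    (h : p.OpenGiven S) : OP E S a p.len p.vtx where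
  first := p.first
  inj := p.inj
  adj := p.adj
  nc i hi hn := h.1 (i + 1) (by omega) hi (fun hc => hn ⟨hc.2.2.1, hc.2.2.2⟩)
  co i hi h1 h2 := h.2 (i + 1) ⟨by omega, hi, h1, h2⟩

theorem OP.dr {E : V → V → Prop} (hdag : Irreflexive (Relation.TransGen E))
    {S : Set V} {w x : V} {n a : ℕ} {v : ℕ → V} (hw : w ∉ insert x S)
    (h : OP E S w n v) (ha : a ≤ n) (hx : v a = x) :
    ∀ j, j + 1 ≤ a → (E (v j) (v (j + 1)) → DR E (insert x S) w (v (j + 1)) true) ∧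
      (E (v (j + 1)) (v j) → DR E (insert x S) w (v (j + 1)) false) := by
  intro j
  induction j with
  | zero =>
    intro hj
    have h0 : DR E (insert x S) w (v 0) false := by rw [h.first]; exact DR.start
    have h0' : v 0 ∉ insert x S := by rw [h.first]; exact hw
    exact ⟨fun e => h0.child h0' e, fun e => h0.parF h0' e⟩
  | succ j ih =>
    intro hj
    have ih := ih (by omega)
    have hne : v (j + 1) ≠ x := by
      rw [← hx]; intro h'
      have := h.inj _ _ (by omega) ha h'
      omega
    have hnc : ¬ (E (v j) (v (j + 1)) ∧ E (v (j + 2)) (v (j + 1))) → v (j + 1) ∉ insert x S := by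
      intro h1 h2
      rcases h2 with h2 | h2
      · exact hne h2
      · exact h.nc j (by omega) h1 h2
    constructor
    · intro e
      have h1 := hnc (fun h' => dag_asymm_s5 hdag e h'.2)
      rcases h.adj j (by omega) with h2 | h2
      · exact (ih.1 h2).child h1 e
      · exact (ih.2 h2).child h1 e
    · intro e
      rcases h.adj j (by omega) with h2 | h2
      · obtain ⟨d, hd, hd2⟩ := h.co j (by omega) h2 e
        exact (ih.1 h2).parT ⟨d, Or.inr hd, hd2⟩ e
      · exact (ih.2 h2).parF (hnc fun h' => dag_asymm_s5 hdag h2 h'.1) e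

/-- The graphical heart: the vertex `x` whose addition blocks is a strict ancestor
of `y`, and is reached by an open walk pointing into it. -/
theorem graph_core {E : V → V → Prop} (hdag : Irreflexive (Relation.TransGen E))
    {S : Set V} {w x y : V} (hw : w ∉ insert x S)
    (hxS : ¬ AnS E S x) (hxw : ¬ Anc E x w) (hxy : x ≠ y)
    (hc : ¬ DSep E {w} {y} S) (hs : DSep E {w} {y} (insert x S)) :
    Relation.TransGen E x y ∧ DR E (insert x S) w x true := by
  unfold DSep at hc
  push Not at hc
  obtain ⟨_, rfl, _, rfl, p, hp⟩ := hc
  have hv := OP.of_open p hp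
  have hnot := hs _ rfl _ rfl p
  have : ∃ i, i + 1 < p.len ∧ p.vtx (i + 1) = x ∧
      ¬ (E (p.vtx i) (p.vtx (i + 1)) ∧ E (p.vtx (i + 2)) (p.vtx (i + 1))) := by
    by_contra hcon
    push Not at hcon
    apply hnot
    refine ⟨?_, ?_⟩
    · rintro (_ | i) h0 h1 h2
      · omega
      · rintro (h3 | h3)
        · obtain ⟨h4, h5⟩ := hcon i h1 h3
          exact h2 ⟨h0, h1, h4, h5⟩
        · exact hp.1 _ h0 h1 h2 h3
    · intro i hi
      obtain ⟨d, hd, hd2⟩ := hp.2 i hi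
      exact ⟨d, Or.inr hd, hd2⟩
  obtain ⟨a, ha, rfl, hnc⟩ := this
  have e1 : E (p.vtx a) (p.vtx (a + 1)) := by
    rcases p.adj a (by omega) with h | h
    · exact h
    · rcases hv.back a (by omega) h with h' | h'
      · exact (hxS h').elim
      · exact (hxw h').elim
  have e2 : E (p.vtx (a + 1)) (p.vtx (a + 2)) := by
    rcases p.adj (a + 1) (by omega) with h | h
    · exact h
    · exact (hnc ⟨e1, h⟩).elim
  refine ⟨?_, ((hv.dr hdag hw (by omega) rfl) a le_rfl).1 e1⟩
  obtain ⟨c, hcl⟩ : ∃ c, p.len = a + 1 + c + 1 := ⟨p.len - (a + 2), by omega⟩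
  rcases hv.follow e2 c (by omega) with h4 | ⟨_, h4⟩
  · exact (hxS h4).elim
  · rw [← hcl, p.last] at h4; exact h4

/-- Directed continuation: an open walk at `r` extends along a directed path to `y`
when `r` has no descendant in `S`. -/
theorem DR.down {E : V → V → Prop} {S : Set V} {w r y : V} {d : Bool}
    (h : DR E S w r d) (hA : ¬ AnS E S r) (ha : Anc E r y) : ∃ d', DR E S w y d' := by
  induction ha using Relation.ReflTransGen.head_induction_on generalizing d with
  | refl => exact ⟨d, h⟩
  | head e _ ih =>
    exact ih (h.child (fun hS => hA ⟨_, hS, Relation.ReflTransGen.refl⟩) e)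
      (fun h' => hA (h'.step e))

/-- Families of ancestors of `S ∪ {y}` do not cross the reachable set. -/
theorem DR.family {E : V → V → Prop} {S : Set V} {w y : V} (hy : ∀ d, ¬ DR E S w y d)
    {j r s : V} (hj : AnS E S j ∨ Anc E j y) (hr : r = j ∨ E r j) (hs : s = j ∨ E s j)
    (hrS : r ∉ S) (hrT : ∃ d, DR E S w r d) : ∃ d, DR E S w s d := by
  have key : ∀ d, DR E S w j d → d = true → E s j → ∃ d, DR E S w s d := by
    rintro d h rfl e
    by_cases hA : AnS E S j
    · exact ⟨_, h.parT hA e⟩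
    · obtain ⟨d', h'⟩ := h.down hA (hj.resolve_left hA)
      exact (hy _ h').elim
  obtain ⟨d, hrT⟩ := hrT
  rcases hr with rfl | hr
  · rcases hs with rfl | hs
    · exact ⟨d, hrT⟩
    · cases d
      · exact ⟨_, hrT.parF hrS hs⟩
      · exact key _ hrT rfl hs
  · have h1 := hrT.child hrS hr
    rcases hs with rfl | hs
    · exact ⟨_, h1⟩
    · exact key _ h1 rfl hs

/-- Sum of `f` over all assignments agreeing with `x` on `C`. -/
noncomputable def sm (C : Set I) (x : ∀ i, α i) (f : (∀ i, α i) → ℝ) : ℝ :=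
  ∑ v, if (∀ i ∈ C, v i = x i) then f v else 0

theorem prS_eq_sm (p : (∀ i, α i) → ℝ) (S : Set I) (x : ∀ i, α i) : prS p S x = sm S x p := by
  unfold prS sm
  rw [finsum_eq_sum_of_fintype]
  refine Finset.sum_congr rfl fun v _ => ?_
  rw [finsum_eq_if]
  simp only [Set.mem_setOf_eq]

theorem sm_congr {C : Set I} {x x' : ∀ i, α i} (h : ∀ i ∈ C, x i = x' i)
    (f : (∀ i, α i) → ℝ) : sm C x f = sm C x' f := by
  unfold sm
  refine Finset.sum_congr rfl fun v _ => ?_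
  refine if_congr ?_ rfl rfl
  exact forall₂_congr fun i hi => by rw [h i hi]

theorem sm_pos (C : Set I) (x : ∀ i, α i) {f : (∀ i, α i) → ℝ} (hf : ∀ v, 0 < f v) :
    0 < sm C x f := by
  unfold sm
  refine Finset.sum_pos' ?_ ⟨x, Finset.mem_univ _, ?_⟩
  · intro v _
    split_ifs
    · exact (hf v).le
    · exact le_rfl
  · simp [hf x]

theorem sum_split (j : I) (c : α j) (g : (∀ i, α i) → ℝ) :
    ∑ v, g v = ∑ v : ∀ i, α i, if v j = c then ∑ a, g (Function.update v j a) else 0 := by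
  rw [← Finset.sum_filter, ← Finset.sum_product']
  refine Finset.sum_bij' (fun v _ => (Function.update v j c, v j))
    (fun w _ => Function.update w.1 j w.2) ?_ ?_ ?_ ?_ ?_
  · intro v _; simp
  · intro v _; simp
  · intro v _; simp
  · rintro ⟨w, a⟩ hw
    simp only [Finset.mem_product, Finset.mem_filter, Finset.mem_univ, true_and, and_true] at hw
    subst hw
    simp
  · intro v _; simp

theorem sumout_one {C : Set I} {j : I} (hj : j ∉ C) (x : ∀ i, α i)
    {f κ : (∀ i, α i) → ℝ} (hf : ∀ v a, f (Function.update v j a) = f v)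
    (hκ : ∀ v, ∑ a, κ (Function.update v j a) = 1) :
    sm C x (fun v => f v * κ v) = sm (insert j C) x f := by
  unfold sm
  rw [sum_split j (x j)]
  refine Finset.sum_congr rfl fun v _ => ?_
  have h1 : ∀ a, (∀ i ∈ C, Function.update v j a i = x i) ↔ (∀ i ∈ C, v i = x i) := by
    intro a
    refine forall₂_congr fun i hi => ?_
    rw [Function.update_of_ne (by rintro rfl; exact hj hi)]
  simp only [h1, hf, Set.forall_mem_insert]
  by_cases h2 : v j = x j <;> by_cases h3 : ∀ i ∈ C, v i = x i
  · rw [if_pos h2, if_pos ⟨h2, h3⟩]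
    simp only [if_pos h3]
    rw [← Finset.mul_sum, hκ, mul_one]
  · rw [if_pos h2, if_neg (fun h => h3 h.2)]
    simp [if_neg h3]
  · rw [if_neg h2, if_neg (fun h => h2 h.1)]
  · rw [if_neg h2, if_neg (fun h => h2 h.1)]

/-- A family of conditional kernels along the graph. -/
structure IsKer (E : I → I → Prop) (K : I → (∀ i, α i) → ℝ) : Prop where
  dep : ∀ j v v', (∀ i, i = j ∨ E i j → v i = v' i) → K j v = K j v'
  sum : ∀ j v, ∑ a, K j (Function.update v j a) = 1
  pos : ∀ j v, 0 < K j v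

theorem exists_sink {E : I → I → Prop} (hdag : Irreflexive (Relation.TransGen E))
    {B : Finset I} (hB : B.Nonempty) : ∃ j ∈ B, ∀ i ∈ B, ¬ E j i := by
  let R : I → I → Prop := fun a b => Relation.TransGen E b a
  haveI : IsTrans I R := ⟨fun a b c h1 h2 => Relation.TransGen.trans h2 h1⟩
  haveI : Std.Irrefl R := ⟨fun a h => hdag a h⟩
  have hwf : WellFounded R := Finite.wellFounded_of_trans_of_irrefl R
  obtain ⟨j, hj, h⟩ := hwf.has_min (B : Set I) (by exact_mod_cast hB)
  exact ⟨j, hj, fun i hi e => h i hi (Relation.TransGen.single e)⟩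

theorem sumout {E : I → I → Prop} (hdag : Irreflexive (Relation.TransGen E))
    {K : I → (∀ i, α i) → ℝ} (hK : IsKer E K) (x : ∀ i, α i) {f : (∀ i, α i) → ℝ} :
    ∀ (n : ℕ) (B : Finset I) (_ : B.card = n) (C : Set I) (_ : ∀ j ∈ B, j ∉ C)
      (_ : ∀ j ∈ B, ∀ v a, f (Function.update v j a) = f v),
    sm C x (fun v => f v * ∏ j ∈ B, K j v) = sm (C ∪ ↑B) x f := by
  intro n
  induction n with
  | zero =>
    intro B hB C _ _
    obtain rfl := Finset.card_eq_zero.mp hB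
    simp
  | succ n ih =>
    intro B hB C hC hf
    obtain ⟨j, hj, hsink⟩ := exists_sink hdag (B := B) (Finset.card_pos.mp (by omega))
    have h1 : (fun v => f v * ∏ i ∈ B, K i v)
        = (fun v => (f v * ∏ i ∈ B.erase j, K i v) * K j v) := by
      funext v
      rw [mul_assoc, Finset.prod_erase_mul _ _ hj]
    rw [h1, sumout_one (hC j hj) x ?_ (hK.sum j),
      ih (B.erase j) (by rw [Finset.card_erase_of_mem hj, hB]; rfl) (insert j C) ?_ ?_]
    · congr 1
      ext i
      simp only [Set.mem_union, Set.mem_insert_iff, Finset.coe_erase, Set.mem_diff,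
        Finset.mem_coe, Set.mem_singleton_iff]
      by_cases h : i = j
      · subst h; simp [hj]
      · simp [h]
    · intro i hi
      rw [Finset.mem_erase] at hi
      rintro (h | h)
      · exact hi.1 h
      · exact hC i hi.2 h
    · intro i hi; exact hf i (Finset.mem_of_mem_erase hi)
    · intro v a
      rw [hf j hj]
      congr 1
      refine Finset.prod_congr rfl fun i hi => ?_
      rw [Finset.mem_erase] at hi
      refine hK.dep i _ _ fun l hl => ?_
      refine Function.update_of_ne ?_ _ _
      rintro rfl
      rcases hl with h | h
      · exact hi.1 h.symm
      · exact hsink i hi.2 h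

/-- Replace the `T`-coordinates of `v` by those of `v'`. -/
noncomputable def sw (T : Set I) (v v' : ∀ i, α i) : ∀ i, α i :=
  fun i => if i ∈ T then v' i else v i

theorem ite_mul_ite_zero (a b : Prop) [Decidable a] [Decidable b] (s t : ℝ) :
    (if a then s else 0) * (if b then t else 0) = if a ∧ b then s * t else 0 := by
  by_cases ha : a <;> by_cases hb : b <;> simp [ha, hb]

theorem swap_lemma {D T : Set I} {Y : I} (hY : Y ∉ T) (x : ∀ i, α i)
    {κ P : (∀ i, α i) → ℝ}
    (hP : ∀ v v', (∀ i ∈ D, v i = x i) → (∀ i ∈ D, v' i = x i) →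
      P (sw T v v') * P (sw T v' v) = P v * P v')
    (hκ : ∀ v v', (∀ i ∈ D, v i = x i) → (∀ i ∈ D, v' i = x i) → κ (sw T v v') = κ v') :
    sm (insert Y D) x (fun v => κ v * P v) * sm D x P =
      sm (insert Y D) x P * sm D x (fun v => κ v * P v) := by
  unfold sm
  rw [Finset.sum_mul_sum, Finset.sum_mul_sum, ← Finset.sum_product', ← Finset.sum_product']
  have hinv : ∀ v v' : ∀ i, α i, sw T (sw T v v') (sw T v' v) = v := by
    intro v v'; funext i; unfold sw; by_cases h : i ∈ T <;> simp [h]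
  let e : ((∀ i, α i) × (∀ i, α i)) ≃ ((∀ i, α i) × (∀ i, α i)) :=
    { toFun := fun w => (sw T w.1 w.2, sw T w.2 w.1)
      invFun := fun w => (sw T w.1 w.2, sw T w.2 w.1)
      left_inv := fun w => by simp [hinv]
      right_inv := fun w => by simp [hinv] }
  rw [Finset.univ_product_univ, ← Equiv.sum_comp e]
  refine Finset.sum_congr rfl ?_
  rintro ⟨v, v'⟩ _
  simp only [e, Equiv.coe_fn_mk, ite_mul_ite_zero, Set.forall_mem_insert]
  have hYv : sw T v v' Y = v Y := by simp [sw, hY]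
  have hiff : ((sw T v v' Y = x Y ∧ ∀ i ∈ D, sw T v v' i = x i) ∧ ∀ i ∈ D, sw T v' v i = x i) ↔
      ((v Y = x Y ∧ ∀ i ∈ D, v i = x i) ∧ ∀ i ∈ D, v' i = x i) := by
    rw [hYv]
    constructor
    · rintro ⟨⟨h0, h1⟩, h2⟩
      refine ⟨⟨h0, fun i hi => ?_⟩, fun i hi => ?_⟩
      · have a := h1 i hi
        have b := h2 i hi
        unfold sw at a b
        by_cases h : i ∈ T <;> simp only [h, if_true, if_false] at a b <;> assumption
      · have a := h1 i hi
        have b := h2 i hi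
        unfold sw at a b
        by_cases h : i ∈ T <;> simp only [h, if_true, if_false] at a b <;> assumption
    · rintro ⟨⟨h0, h1⟩, h2⟩
      refine ⟨⟨h0, fun i hi => ?_⟩, fun i hi => ?_⟩
      · unfold sw; split_ifs
        · exact h2 i hi
        · exact h1 i hi
      · unfold sw; split_ifs
        · exact h1 i hi
        · exact h2 i hi
  by_cases hc : (v Y = x Y ∧ ∀ i ∈ D, v i = x i) ∧ ∀ i ∈ D, v' i = x i
  · rw [if_pos (hiff.2 hc), if_pos hc, hκ v v' hc.1.2 hc.2]
    have := hP v v' hc.1.2 hc.2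
    linear_combination κ v' * this
  · rw [if_neg (fun h => hc (hiff.1 h)), if_neg hc]

theorem step_lemma {E : I → I → Prop} (hdag : Irreflexive (Relation.TransGen E))
    {K : I → (∀ i, α i) → ℝ} (hK : IsKer E K) (x : ∀ i, α i)
    {A C T : Set I} {X0 Y : I} (hA : ∀ i j, E i j → j ∈ A → i ∈ A)
    (hCA : C ⊆ A) (hYA : Y ∈ A) (hXC : X0 ∈ C) (hYT : Y ∉ T)
    (hfam : ∀ j ∈ A, ∀ r s, (r = j ∨ E r j) → (s = j ∨ E s j) → r ∉ C → s ∉ C → r ∈ T → s ∈ T)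
    (hX0 : ∀ s, E s X0 → s ∉ C → s ∈ T)
    {J : Finset I} (hXJ : X0 ∉ J) (hJ : ∀ j, j ∉ A → j ∈ J) :
    sm (insert Y C) x (fun v => ∏ j ∈ insert X0 J, K j v) * sm C x (fun v => ∏ j ∈ J, K j v) =
      sm (insert Y C) x (fun v => ∏ j ∈ J, K j v) *
        sm C x (fun v => ∏ j ∈ insert X0 J, K j v) := by
  set B : Finset I := Finset.univ.filter (fun j => j ∉ A) with hB
  set P : (∀ i, α i) → ℝ := fun v => ∏ j ∈ J.filter (fun j => j ∈ A), K j v with hP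
  have hBJ : J.filter (fun j => ¬ j ∈ A) = B := by
    ext j
    simp only [hB, Finset.mem_filter, Finset.mem_univ, true_and]
    exact ⟨fun h => h.2, fun h => ⟨hJ j h, h⟩⟩
  have e1 : (fun v => ∏ j ∈ J, K j v) = fun v => P v * ∏ j ∈ B, K j v := by
    funext v
    rw [← hBJ]
    exact (Finset.prod_filter_mul_prod_filter_not J (fun j => j ∈ A) _).symm
  have e2 : (fun v => ∏ j ∈ insert X0 J, K j v)
      = fun v => (K X0 v * P v) * ∏ j ∈ B, K j v := by
    funext v
    rw [Finset.prod_insert hXJ, congrFun e1 v, mul_assoc]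
  have hPdep : ∀ v v' : ∀ i, α i, (∀ i ∈ A, v i = v' i) → P v = P v' := by
    intro v v' h
    refine Finset.prod_congr rfl fun j hj => hK.dep j _ _ fun i hi => h i ?_
    have hjA := (Finset.mem_filter.mp hj).2
    rcases hi with rfl | hi
    · exact hjA
    · exact hA i j hi hjA
  have hKdep : ∀ v v' : ∀ i, α i, (∀ i ∈ A, v i = v' i) → K X0 v = K X0 v' := by
    intro v v' h
    refine hK.dep _ _ _ fun i hi => h i ?_
    rcases hi with rfl | hi
    · exact hCA hXC
    · exact hA i _ hi (hCA hXC)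
  have hBA : ∀ j ∈ B, j ∉ A := fun j hj => (Finset.mem_filter.mp hj).2
  have hup : ∀ j ∈ B, ∀ (v : ∀ i, α i) a, ∀ i ∈ A, Function.update v j a i = v i := by
    intro j hj v a i hi
    exact Function.update_of_ne (by rintro rfl; exact hBA _ hj hi) _ _
  have hYC : ∀ j ∈ B, j ∉ insert Y C := by
    rintro j hj (rfl | h)
    · exact hBA _ hj hYA
    · exact hBA _ hj (hCA h)
  have hCB : ∀ j ∈ B, j ∉ C := fun j hj h => hBA _ hj (hCA h)
  have d1 : ∀ j ∈ B, ∀ v a, P (Function.update v j a) = P v :=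
    fun j hj v a => hPdep _ _ (hup j hj v a)
  have d2 : ∀ j ∈ B, ∀ v a, (fun v => K X0 v * P v) (Function.update v j a)
      = (fun v => K X0 v * P v) v :=
    fun j hj v a => by
      simp only
      rw [hPdep _ _ (hup j hj v a), hKdep _ _ (hup j hj v a)]
  rw [e1, e2, sumout hdag hK x (f := fun v => K X0 v * P v) _ B rfl _ hYC d2,
    sumout hdag hK x (f := P) _ B rfl _ hCB d1,
    sumout hdag hK x (f := P) _ B rfl _ hYC d1,
    sumout hdag hK x (f := fun v => K X0 v * P v) _ B rfl _ hCB d2, Set.insert_union]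
  have hsame : ∀ v v' : ∀ i, α i, (∀ i ∈ C ∪ ↑B, v i = x i) → (∀ i ∈ C ∪ ↑B, v' i = x i) →
      ∀ j, (∀ s, (s = j ∨ E s j) → s ∉ C → s ∈ T) → K j (sw T v v') = K j v' := by
    intro v v' hv hv' j hj
    refine hK.dep _ _ _ fun i hi => ?_
    by_cases hiC : i ∈ C
    · unfold sw
      rw [hv i (Or.inl hiC), hv' i (Or.inl hiC), ite_self]
    · simp [sw, hj i hi hiC]
  have hsame' : ∀ v v' : ∀ i, α i, (∀ i ∈ C ∪ ↑B, v i = x i) → (∀ i ∈ C ∪ ↑B, v' i = x i) →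
      ∀ j, (∀ s, (s = j ∨ E s j) → s ∉ C → s ∉ T) → K j (sw T v v') = K j v := by
    intro v v' hv hv' j hj
    refine hK.dep _ _ _ fun i hi => ?_
    by_cases hiC : i ∈ C
    · unfold sw
      rw [hv i (Or.inl hiC), hv' i (Or.inl hiC), ite_self]
    · simp [sw, hj i hi hiC]
  refine swap_lemma (D := C ∪ ↑B) (T := T) hYT x ?_ ?_
  · intro v v' hv hv'
    simp only [hP]
    rw [← Finset.prod_mul_distrib, ← Finset.prod_mul_distrib]
    refine Finset.prod_congr rfl fun j hj => ?_
    have hjA := (Finset.mem_filter.mp hj).2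
    by_cases hr : ∃ r, (r = j ∨ E r j) ∧ r ∉ C ∧ r ∈ T
    · obtain ⟨r, h1, h2, h3⟩ := hr
      have h4 : ∀ s, (s = j ∨ E s j) → s ∉ C → s ∈ T :=
        fun s hs hsC => hfam j hjA r s h1 hs h2 hsC h3
      rw [hsame v v' hv hv' j h4, hsame v' v hv' hv j h4, mul_comm]
    · have h4 : ∀ s, (s = j ∨ E s j) → s ∉ C → s ∉ T :=
        fun s hs hsC hsT => hr ⟨s, hs, hsC, hsT⟩
      rw [hsame' v v' hv hv' j h4, hsame' v' v hv' hv j h4]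
  · intro v v' hv hv'
    refine hsame v v' hv hv' X0 ?_
    rintro s (rfl | hs) hsC
    · exact (hsC hXC).elim
    · exact hX0 s hs hsC

theorem isKer_condPr {E : I → I → Prop} (hdag : Irreflexive (Relation.TransGen E))
    {q : (∀ i, α i) → ℝ} (hq : ∀ v, 0 < q v) :
    IsKer E (fun j => condPr q {j} {i | E i j}) where
  dep j v v' h := by
    unfold condPr
    simp only [prS_eq_sm]
    rw [sm_congr (x := v) (x' := v') (C := {j} ∪ {i | E i j}) (by
      rintro i (hi | hi)
      · exact h i (Or.inl hi)
      · exact h i (Or.inr hi)),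
      sm_congr (x := v) (x' := v') (C := {i | E i j}) (fun i hi => h i (Or.inr hi))]
  sum j v := by
    unfold condPr
    simp only [prS_eq_sm]
    have hjj : ¬ E j j := fun h => hdag j (Relation.TransGen.single h)
    have h1 : ∀ a, sm {i | E i j} (Function.update v j a) q = sm {i | E i j} v q := by
      intro a
      refine sm_congr (fun i hi => Function.update_of_ne ?_ _ _) _
      rintro rfl
      exact hjj hi
    simp only [h1]
    rw [← Finset.sum_div, div_eq_one_iff_eq (sm_pos _ _ hq).ne']
    unfold sm
    rw [Finset.sum_comm]
    refine Finset.sum_congr rfl fun u _ => ?_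
    have h2 : ∀ a, (∀ i ∈ ({j} ∪ {i | E i j} : Set I), u i = Function.update v j a i) ↔
        (u j = a ∧ ∀ i ∈ {i | E i j}, u i = v i) := by
      intro a
      rw [Set.singleton_union, Set.forall_mem_insert, Function.update_self]
      refine and_congr_right fun _ => forall₂_congr fun i hi => ?_
      rw [Function.update_of_ne]
      rintro rfl
      exact hjj hi
    simp only [h2, ite_and]
    rw [Finset.sum_ite_eq]
    simp
  pos j v := by
    unfold condPr
    simp only [prS_eq_sm]
    exact div_pos (sm_pos _ _ hq) (sm_pos _ _ hq)

theorem chain_lemma {E : I → I → Prop} (hdag : Irreflexive (Relation.TransGen E))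
    {K : I → (∀ i, α i) → ℝ} (hK : IsKer E K) (m : ∀ i, α i)
    {k : ℕ} {X : Fin (k + 1) → I} (hXinj : Function.Injective X) {Y : I} {Z : Set I}
    (hXanc : ∀ i, Relation.TransGen E (X i) Y)
    (w : Fin (k + 1) → I)
    (hYT : ∀ i d, ¬ DR E (insert (X i) (Z ∪ X '' {j | j < i})) (w i) Y d)
    (hDR : ∀ i, DR E (insert (X i) (Z ∪ X '' {j | j < i})) (w i) (X i) true) :
    ∀ t : ℕ, t ≤ k + 1 →
    sm (insert Y (Set.range X ∪ Z)) m
        (fun v => ∏ j ∈ Finset.univ.filter (fun j => j ∉ X '' {l | t ≤ l.val}), K j v) *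
      sm (Set.range X ∪ Z) m
        (fun v => ∏ j ∈ Finset.univ.filter (fun j => j ∉ Set.range X), K j v) =
    sm (insert Y (Set.range X ∪ Z)) m
        (fun v => ∏ j ∈ Finset.univ.filter (fun j => j ∉ Set.range X), K j v) *
      sm (Set.range X ∪ Z) m
        (fun v => ∏ j ∈ Finset.univ.filter (fun j => j ∉ X '' {l | t ≤ l.val}), K j v) := by
  intro t
  induction t with
  | zero => intro _; simp
  | succ t ih =>
    intro ht
    have ih := ih (by omega)
    set i : Fin (k + 1) := ⟨t, by omega⟩ with hi
    have hJ : Finset.univ.filter (fun j => j ∉ X '' {l | t + 1 ≤ l.val}) =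
        insert (X i) (Finset.univ.filter (fun j => j ∉ X '' {l | t ≤ l.val})) := by
      ext j
      simp only [Finset.mem_filter, Finset.mem_univ, true_and, Finset.mem_insert, Set.mem_image,
        Set.mem_setOf_eq, not_exists, not_and]
      constructor
      · intro h
        by_cases hj : j = X i
        · exact Or.inl hj
        · right
          intro l hl hlj
          refine h l ?_ hlj
          rcases Nat.lt_or_eq_of_le hl with h1 | h1
          · exact h1
          · exact (hj (by rw [← hlj]; congr 1; ext; exact h1.symm)).elim
      · rintro (rfl | h) l hl hlj
        · have := congrArg Fin.val (hXinj hlj)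
          simp only [hi] at this
          omega
        · exact h l (by omega) hlj
    have hst := step_lemma hdag hK m
      (A := {j | AnS E Z j ∨ Anc E j Y}) (C := Set.range X ∪ Z)
      (T := {r | ∃ d, DR E (insert (X i) (Z ∪ X '' {j | j < i})) (w i) r d})
      (X0 := X i) (Y := Y)
      (J := Finset.univ.filter (fun j => j ∉ X '' {l | t ≤ l.val}))
      (by
        rintro a b e (h | h)
        · exact Or.inl (h.step e)
        · exact Or.inr (Relation.ReflTransGen.head e h))
      (by
        rintro a (⟨l, rfl⟩ | h)
        · exact Or.inr (hXanc l).to_reflTransGen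
        · exact Or.inl ⟨a, h, Relation.ReflTransGen.refl⟩)
      (Or.inr Relation.ReflTransGen.refl)
      (Or.inl ⟨i, rfl⟩)
      (by rintro ⟨d, h⟩; exact hYT i d h)
      (by
        intro j hj r s hr hs hrC _ hrT
        refine DR.family (hYT i) ?_ hr hs ?_ hrT
        · rcases hj with ⟨z, hz, h⟩ | h
          · exact Or.inl ⟨z, Or.inr (Or.inl hz), h⟩
          · exact Or.inr h
        · rintro (rfl | h | ⟨l, _, rfl⟩)
          · exact hrC (Or.inl ⟨i, rfl⟩)
          · exact hrC (Or.inr h)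
          · exact hrC (Or.inl ⟨l, rfl⟩))
      (by
        intro s e _
        exact ⟨_, (hDR i).parT ⟨X i, Or.inl rfl, Relation.ReflTransGen.refl⟩ e⟩)
      (by
        simp only [Finset.mem_filter, Finset.mem_univ, true_and, not_not]
        exact ⟨i, by simp [hi], rfl⟩)
      (by
        intro j hj
        simp only [Finset.mem_filter, Finset.mem_univ, true_and]
        rintro ⟨l, _, rfl⟩
        exact hj (Or.inr (hXanc l).to_reflTransGen))
    rw [hJ]
    have hpos : 0 < sm (Set.range X ∪ Z) m
        (fun v => ∏ j ∈ Finset.univ.filter (fun j => j ∉ X '' {l | t ≤ l.val}), K j v) :=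
      sm_pos _ _ fun v => Finset.prod_pos fun j _ => hK.pos j v
    apply mul_right_cancel₀ hpos.ne'
    linear_combination
      (sm (Set.range X ∪ Z) m
        (fun v => ∏ j ∈ Finset.univ.filter (fun j => j ∉ Set.range X), K j v)) * hst +
      (sm (Set.range X ∪ Z) m (fun v => ∏ j ∈ insert (X i)
        (Finset.univ.filter (fun j => j ∉ X '' {l | t ≤ l.val})), K j v)) * ih

/-- Truncating the kernels of `X` does not change the marginal of nondescendants `Z`. -/
theorem marg_lemma {E : I → I → Prop} (hdag : Irreflexive (Relation.TransGen E))
    {K : I → (∀ i, α i) → ℝ} (hK : IsKer E K) (m : ∀ i, α i) {X Z : Set I}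
    (hXZ : ∀ x ∈ X, ¬ AnS E Z x) :
    sm (X ∪ Z) m (fun v => ∏ j ∈ Finset.univ.filter (fun j => j ∉ X), K j v) =
      sm Z m (fun v => ∏ j, K j v) := by
  set P : (∀ i, α i) → ℝ := fun v => ∏ j ∈ Finset.univ.filter (fun j => AnS E Z j), K j v with hP
  have e1 : (fun v => ∏ j, K j v) =
      fun v => P v * ∏ j ∈ Finset.univ.filter (fun j => ¬ AnS E Z j), K j v := by
    funext v
    exact (Finset.prod_filter_mul_prod_filter_not Finset.univ _ _).symm
  have e2 : (fun v => ∏ j ∈ Finset.univ.filter (fun j => j ∉ X), K j v) =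
      fun v => P v * ∏ j ∈ Finset.univ.filter (fun j => ¬ AnS E Z j ∧ j ∉ X), K j v := by
    funext v
    rw [← Finset.prod_filter_mul_prod_filter_not _ (fun j => AnS E Z j)]
    rw [Finset.filter_filter, Finset.filter_filter, hP]
    congr 1
    · refine Finset.prod_congr ?_ fun _ _ => rfl
      ext j
      simp only [Finset.mem_filter, Finset.mem_univ, true_and]
      exact ⟨fun h => h.2, fun h => ⟨fun hx => hXZ j hx h, h⟩⟩
    · refine Finset.prod_congr ?_ fun _ _ => rfl
      ext j
      simp only [Finset.mem_filter, Finset.mem_univ, true_and]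
      exact and_comm
  have hdep : ∀ j, ¬ AnS E Z j → ∀ v a, P (Function.update v j a) = P v := by
    intro j hj v a
    refine Finset.prod_congr rfl fun l hl => hK.dep _ _ _ fun i hi => ?_
    refine Function.update_of_ne ?_ _ _
    rintro rfl
    have hl := (Finset.mem_filter.mp hl).2
    rcases hi with rfl | hi
    · exact hj hl
    · exact hj (hl.step hi)
  have hZ : ∀ z ∈ Z, AnS E Z z := fun z hz => ⟨z, hz, Relation.ReflTransGen.refl⟩
  rw [e1, e2, sumout hdag hK m _ _ rfl, sumout hdag hK m _ _ rfl]
  · congr 1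
    ext j
    simp only [Set.mem_union, Finset.coe_filter, Finset.mem_univ, true_and, Set.mem_setOf_eq]
    have := hXZ j
    tauto
  · intro j hj h
    exact (Finset.mem_filter.mp hj).2 (hZ j h)
  · intro j hj
    exact hdep j (Finset.mem_filter.mp hj).2
  · rintro j hj (h | h)
    · exact (Finset.mem_filter.mp hj).2.2 h
    · exact (Finset.mem_filter.mp hj).2.1 (hZ j h)
  · intro j hj
    exact hdep j (Finset.mem_filter.mp hj).2.1

theorem adjust_final {E : I → I → Prop} {X Z : Set I} {Y : I} (hXZ : Disjoint X Z)
    (hYX : Y ∉ X) (hYZ : Y ∉ Z) (q : (∀ i, α i) → ℝ) (x y : ∀ i, α i)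
    (h : ∀ m, condPr q {Y} (X ∪ Z) m * prS q Z m =
      sm (insert Y (X ∪ Z)) m (fun v => ∏ j ∈ Finset.univ.filter (fun j => j ∉ X),
        condPr q {j} {i | E i j} v)) :
    (∑ᶠ v ∈ {v : ∀ i, α i | ∀ i ∈ ({Y} : Set I), v i = y i}, doPMF q E X x v) =
      ∑ᶠ z : (∀ j : Z, α j.1),
        condPr q {Y} (X ∪ Z) (mergeVals X Z x z y) * prS q Z (mergeVals X Z x z y) := by
  rw [finsum_eq_sum_of_fintype, finsum_eq_sum_of_fintype]
  simp only [h]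
  unfold sm
  rw [Finset.sum_comm]
  refine Finset.sum_congr rfl fun v _ => ?_
  rw [finsum_eq_if]
  have hprod : ∏ᶠ i ∈ Xᶜ, condPr q {i} {j | E j i} v =
      ∏ j ∈ Finset.univ.filter (fun j => j ∉ X), condPr q {j} {i | E i j} v := by
    rw [finprod_eq_prod_of_fintype, Finset.prod_filter]
    refine Finset.prod_congr rfl fun j _ => ?_
    rw [finprod_eq_if]
    simp only [Set.mem_compl_iff]
  have hiff : ∀ z : (∀ j : Z, α j.1),
      (∀ i ∈ insert Y (X ∪ Z), v i = mergeVals X Z x z y i) ↔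
        (z = (fun j : Z => v j.1) ∧ (v Y = y Y ∧ ∀ i ∈ X, v i = x i)) := by
    intro z
    have hx : ∀ i ∈ X, mergeVals X Z x z y i = x i := by
      intro i hi
      have : i ∉ Z := fun h' => Set.disjoint_left.mp hXZ hi h'
      simp [mergeVals, this, hi]
    have hy : mergeVals X Z x z y Y = y Y := by simp [mergeVals, hYX, hYZ]
    have hz : ∀ j : Z, mergeVals X Z x z y j.1 = z j := by
      intro j; simp [mergeVals, j.2]
    rw [Set.forall_mem_insert, hy]
    constructor
    · rintro ⟨h1, h2⟩
      refine ⟨?_, h1, fun i hi => ?_⟩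
      · funext j
        rw [h2 j.1 (Or.inr j.2), hz]
      · rw [h2 i (Or.inl hi), hx i hi]
    · rintro ⟨rfl, h1, h2⟩
      refine ⟨h1, ?_⟩
      rintro i (hi | hi)
      · rw [hx i hi, h2 i hi]
      · exact (hz ⟨i, hi⟩).symm
  simp only [hiff, ite_and]
  rw [Finset.sum_ite_eq']
  simp only [Finset.mem_univ, if_true, doPMF, hprod, Set.mem_setOf_eq, Set.mem_singleton_iff,
    forall_eq]

/-- **R1 Build.** Given a positive pmf `p` Markov compatible with and faithful to the
DAG `E`, with treatments `X 0 < ⋯ < X k` and witnesses `Wf i` satisfying the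
conditional dependence/independence conditions, every `X i` has a directed path to `Y`
with at least one edge and `Z` is an adjustment set relative to `(range X, {Y})`. -/
theorem stmt_5 (E : I → I → Prop)
    (hdag : Irreflexive (Relation.TransGen E))
    (p : (∀ i, α i) → ℝ) (hpmf : IsPMF p) (hpos : ∀ v, 0 < p v)
    (hmarkov : MarkovCompat p E) (hfaith : Faithful p E)
    (k : ℕ) (X : Fin (k + 1) → I) (hXinj : Function.Injective X)
    (Y : I) (W : Set I)
    (hXY : ∀ i, X i ≠ Y) (hXW : ∀ i, X i ∉ W) (hYW : Y ∉ W)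
    (hordWX : ∀ i, ∀ w ∈ W, ¬ Anc E (X i) w)
    (hordWY : ∀ w ∈ W, ¬ Anc E Y w)
    (hordXX : ∀ i j : Fin (k + 1), i < j → ¬ Anc E (X j) (X i))
    (hordXY : ∀ i, ¬ Anc E Y (X i))
    (Wf : Fin (k + 1) → I) (hWf : ∀ i, Wf i ∈ W)
    (Z : Set I) (hZ : Z ⊆ W \ Set.range Wf)
    (hdep : ∀ i, ¬ CondIndep p {Wf i} {Y} (Z ∪ X '' {j : Fin (k + 1) | j < i}))
    (hindep : ∀ i, CondIndep p {Wf i} {Y} (Z ∪ X '' {j : Fin (k + 1) | j ≤ i})) :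
    (∀ i, Relation.TransGen E (X i) Y) ∧
      IsAdjustmentSet (α := α) E (Set.range X) {Y} Z := by
  have hins : ∀ i, Z ∪ X '' {j : Fin (k + 1) | j ≤ i} =
      insert (X i) (Z ∪ X '' {j : Fin (k + 1) | j < i}) := by
    intro i
    have : {j : Fin (k + 1) | j ≤ i} = insert i {j | j < i} := by
      ext j; simp only [Set.mem_setOf_eq, Set.mem_insert_iff]; exact le_iff_eq_or_lt
    rw [this, Set.image_insert_eq, Set.union_insert]
  have hwS : ∀ i, Wf i ∉ insert (X i) (Z ∪ X '' {j : Fin (k + 1) | j < i}) := by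
    rintro i (h | h | ⟨l, _, h⟩)
    · exact hXW i (h ▸ hWf i)
    · exact (hZ h).2 ⟨i, rfl⟩
    · exact hXW l (h ▸ hWf i)
  have hYS : ∀ i, Y ∉ insert (X i) (Z ∪ X '' {j : Fin (k + 1) | j < i}) := by
    rintro i (h | h | ⟨l, _, h⟩)
    · exact hXY i h.symm
    · exact hYW (hZ h).1
    · exact hXY l h
  have hwY : ∀ i, Wf i ≠ Y := fun i h => hYW (h ▸ hWf i)
  have hXS : ∀ i, ¬ AnS E (Z ∪ X '' {j : Fin (k + 1) | j < i}) (X i) := by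
    rintro i ⟨d, hd | ⟨l, hl, rfl⟩, h⟩
    · exact hordWX i d (hZ hd).1 h
    · exact hordXX l i hl h
  have hd1 : ∀ i, ¬ DSep E {Wf i} {Y} (Z ∪ X '' {j : Fin (k + 1) | j < i}) := by
    intro i
    rw [← hfaith _ _ _ (by simpa using hwY i)]
    · exact hdep i
    · rw [Set.disjoint_left]
      rintro a ha (h | h)
      · exact hwS i (Or.inr (h ▸ ha))
      · exact hYS i (Or.inr (h ▸ ha))
  have hd2 : ∀ i, DSep E {Wf i} {Y} (insert (X i) (Z ∪ X '' {j : Fin (k + 1) | j < i})) := by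
    intro i
    rw [← hfaith _ _ _ (by simpa using hwY i), ← hins]
    · exact hindep i
    · rw [Set.disjoint_left]
      rintro a ha (h | h)
      · exact hwS i (h ▸ ha)
      · exact hYS i (h ▸ ha)
  have hcore := fun i => graph_core hdag (hwS i) (hXS i) (hordWX i _ (hWf i)) (hXY i)
    (hd1 i) (hd2 i)
  refine ⟨fun i => (hcore i).1, ?_⟩
  intro q _ hqpos hqM x y
  have hK := isKer_condPr hdag hqpos
  have hq : q = fun v => ∏ j, condPr q {j} {i | E i j} v := by
    funext v
    rw [← finprod_eq_prod_of_fintype]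
    exact hqM v
  refine adjust_final ?_ ?_ ?_ q x y ?_
  · rw [Set.disjoint_left]
    rintro _ ⟨i, rfl⟩ h
    exact hXW i (hZ h).1
  · rintro ⟨i, h⟩; exact hXY i h
  · exact fun h => hYW (hZ h).1
  · intro m
    have hch := chain_lemma hdag hK m hXinj (fun i => (hcore i).1) Wf
      (fun i d h => h.not_dsep hdag (hwS i) (hwY i) (hd2 i)) (fun i => (hcore i).2) (k + 1) le_rfl
    have hmg := marg_lemma hdag hK m (X := Set.range X) (Z := Z) (by
      rintro _ ⟨i, rfl⟩ ⟨d, hd, h⟩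
      exact hordWX i d (hZ hd).1 h)
    have hemp : X '' {l | k + 1 ≤ l.val} = ∅ := by
      rw [Set.image_eq_empty]
      ext l
      simp only [Set.mem_setOf_eq, Set.mem_empty_iff_false, iff_false]
      omega
    rw [hemp] at hch
    simp only [Set.mem_empty_iff_false, not_false_eq_true, Finset.filter_true] at hch
    rw [← hq] at hch hmg
    change prS q ({Y} ∪ (Set.range X ∪ Z)) m / prS q (Set.range X ∪ Z) m * prS q Z m = _
    rw [prS_eq_sm, prS_eq_sm, prS_eq_sm, Set.singleton_union, ← hmg,
      div_mul_eq_mul_div, div_eq_iff (sm_pos _ _ hqpos).ne']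
    convert hch
end
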